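/- Let g : A → A be a covering map of the open annulus and let K ⊆ A be a compact set. Then there exists a covering map g' : S¹ × [0,1] → S¹ × [0,1] of the closed annulus such that g'(x) = g(x) for every x ∈ K, where A = S¹ × (0,1) is regarded as a subset of S¹ × [0,1]. -/

import Mathlib

open Set Filter Topology

noncomputable section

/-- The open annulus `A = S¹ × (0,1)`. -/
abbrev Ann : Type := Circle × (Set.Ioo (0:ℝ) 1)

/-- The universal cover `Ã = ℝ × (0,1)`. -/
abbrev AnnTil : Type := ℝ × (Set.Ioo (0:ℝ) 1)

/-- The covering projection `π(x,y) = (exp(2πix), y)`. -/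
def pr : AnnTil → Ann := fun z => (Circle.exp (2 * Real.pi * z.1), z.2)

/-- Translation by an integer in the first coordinate: `z + k`. -/
def tr (z : AnnTil) (k : ℤ) : AnnTil := (z.1 + k, z.2)

/-- `F` is a lift of `f`. -/
def IsLift (f : Ann → Ann) (F : AnnTil → AnnTil) : Prop :=
  Continuous F ∧ pr ∘ F = f ∘ pr

/-- `f` has degree `d`: some lift satisfies `F(z+1) = F(z) + d`. -/
def HasDegree (f : Ann → Ann) (d : ℤ) : Prop :=
  ∃ F : AnnTil → AnnTil, IsLift f F ∧ ∀ z, F (tr z 1) = tr (F z) d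

/-- A subset of the annulus is essential if it is not contained in any
connected, simply connected open subset. -/
def IsEssential (K : Set Ann) : Prop :=
  ¬ ∃ U : Set Ann, IsOpen U ∧ IsConnected U ∧ SimplyConnectedSpace U ∧ K ⊆ U

/-- Nielsen equivalence of fixed points `p`, `q` of `g`: there is a path `γ`
from `p` to `q` homotopic (rel endpoints) to `g ∘ γ`. -/
def NielsenEquiv (g : Ann → Ann) (p q : Ann) : Prop :=
  ∃ (hg : Continuous g) (hp : g p = p) (hq : g q = q) (γ : Path p q),
    γ.Homotopic ((γ.map hg).cast hp.symm hq.symm)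

/-- `g` has exactly `N` Nielsen classes of fixed points. -/
def HasExactlyNielsenClasses (g : Ann → Ann) (N : ℕ) : Prop :=
  ∃ S : Finset Ann, S.card = N ∧ (∀ p ∈ S, g p = p) ∧
    (∀ p ∈ S, ∀ q ∈ S, p ≠ q → ¬ NielsenEquiv g p q) ∧
    (∀ p, g p = p → ∃ q ∈ S, NielsenEquiv g p q)

/-- `Fill K`: the union of `K` with the connected components of its
complement whose closure is compact. -/
def Fill (K : Set Ann) : Set Ann :=
  K ∪ {x | x ∈ Kᶜ ∧ IsCompact (closure (connectedComponentIn Kᶜ x))}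

/-- The closed annulus `S¹ × [0,1]`. -/
abbrev ClAnn : Type := Circle × (Set.Icc (0:ℝ) 1)

/-- The inclusion of the open annulus into the closed annulus. -/
def emb : Ann → ClAnn :=
  fun p => (p.1, ⟨(p.2 : ℝ), Set.Ioo_subset_Icc_self p.2.2⟩)

namespace AnnExt

open Metric

/-- Hurwitz: the limit of nonvanishing functions does not vanish unless locally zero. -/
lemma hurwitz {ι : Type*} {l : Filter ι} [l.NeBot] {F : ι → ℂ → ℂ} {f : ℂ → ℂ} {V : Set ℂ}
    (hV : IsOpen V) (hF : ∀ n, DifferentiableOn ℂ (F n) V)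
    (hlim : TendstoLocallyUniformlyOn F f l V) (hne : ∀ n, ∀ z ∈ V, F n z ≠ 0) {b : ℂ}
    (hb : b ∈ V) (hnz : ¬ ∀ᶠ z in 𝓝 b, f z = 0) : f b ≠ 0 := by
  intro hfb
  have hfd : DifferentiableOn ℂ f V := hlim.differentiableOn (Eventually.of_forall hF) hV
  have han : AnalyticAt ℂ f b := hfd.analyticAt (hV.mem_nhds hb)
  have hev := han.eventually_eq_zero_or_eventually_ne_zero.resolve_left hnz
  rw [eventually_nhdsWithin_iff] at hev
  obtain ⟨r, hr, hrV⟩ := Metric.nhds_basis_closedBall.mem_iff.1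
    (inter_mem hev (hV.mem_nhds hb))
  have hcV : closedBall b r ⊆ V := fun z hz => (hrV hz).2
  have hsph : ∀ z ∈ sphere b r, f z ≠ 0 := fun z hz =>
    (hrV (sphere_subset_closedBall hz)).1 (ne_of_mem_sphere hz hr.ne')
  obtain ⟨z0, hz0, hmin⟩ := (isCompact_sphere b r).exists_isMinOn
    (NormedSpace.sphere_nonempty.2 hr.le)
    ((hfd.continuousOn.mono (sphere_subset_closedBall.trans hcV)).norm)
  set m := ‖f z0‖ with hm
  have hm0 : 0 < m := norm_pos_iff.2 (hsph z0 hz0)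
  have hu := (tendstoLocallyUniformlyOn_iff_forall_isCompact hV).1 hlim _ hcV
    (isCompact_closedBall b r)
  rw [Metric.tendstoUniformlyOn_iff] at hu
  obtain ⟨n, hn⟩ := (hu (m / 3) (by positivity)).exists
  have hFb : ‖F n b‖ < m / 3 := by
    have := hn b (mem_closedBall_self hr.le)
    rwa [hfb, dist_eq_norm, zero_sub, norm_neg] at this
  have hdc : DiffContOnCl ℂ (fun z => (F n z)⁻¹) (ball b r) :=
    DifferentiableOn.diffContOnCl_ball ((hF n).inv (hne n)) hcV
  have hbd : ∀ z ∈ frontier (ball b r), ‖(F n z)⁻¹‖ ≤ (2 * m / 3)⁻¹ := by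
    intro z hz
    rw [frontier_ball _ hr.ne'] at hz
    rw [norm_inv]
    apply inv_anti₀ (by positivity)
    have h1 := hn z (sphere_subset_closedBall hz)
    have h2 : m ≤ ‖f z‖ := hmin hz
    rw [dist_eq_norm] at h1
    have h3 := norm_sub_norm_le (f z) (F n z)
    linarith
  have h4 := Complex.norm_le_of_forall_mem_frontier_norm_le isBounded_ball hdc hbd
    (subset_closure (mem_ball_self hr))
  rw [norm_inv] at h4
  have h5 : 0 < ‖F n b‖ := norm_pos_iff.2 (hne n b hb)
  have h6 := (inv_le_inv₀ h5 (by positivity)).1 h4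
  linarith

/-- Montel's theorem along an ultrafilter. -/
lemma montel {ι : Type*} (l : Ultrafilter ι) {F : ι → ℂ → ℂ} {U : Set ℂ}
    (hU : IsOpen U) (hF : ∀ n, DifferentiableOn ℂ (F n) U)
    (hb : ∀ n, ∀ z ∈ U, ‖F n z‖ ≤ 1) :
    ∃ f : ℂ → ℂ, TendstoLocallyUniformlyOn F f l U := by
  have hex : ∀ z, ∃ w : ℂ, z ∈ U → Tendsto (fun n => F n z) l (𝓝 w) := by
    intro z
    by_cases hz : z ∈ U
    · obtain ⟨w, -, hw⟩ := (isCompact_closedBall (0:ℂ) 1).ultrafilter_le_nhds'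
        (l.map (fun n => F n z)) (by
          rw [Ultrafilter.mem_map]
          refine Filter.mem_of_superset Filter.univ_mem ?_
          intro n _
          simpa using hb n z hz)
      exact ⟨w, fun _ => hw⟩
    · exact ⟨0, fun h => absurd h hz⟩
  choose f hf using hex
  refine ⟨f, ?_⟩
  rw [Metric.tendstoLocallyUniformlyOn_iff]
  intro ε hε z hz
  obtain ⟨r, hr, hrU⟩ := Metric.isOpen_iff.1 hU z hz
  have hlip : ∀ n, ∀ w ∈ ball z r, dist (F n w) (F n z) ≤ 2 / r * dist w z := by
    intro n w hw
    refine Complex.dist_le_div_mul_dist_of_mapsTo_ball ((hF n).mono hrU) ?_ hw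
    intro v hv
    rw [mem_closedBall]
    calc dist (F n v) (F n z) ≤ ‖F n v‖ + ‖F n z‖ := dist_le_norm_add_norm _ _
      _ ≤ 2 := by linarith [hb n v (hrU hv), hb n z hz]
  have hlipf : ∀ w ∈ ball z r, dist (f w) (f z) ≤ 2 / r * dist w z := by
    intro w hw
    exact le_of_tendsto ((hf w (hrU hw)).dist (hf z hz)) (Eventually.of_forall fun n => hlip n w hw)
  set δ := min r (r * ε / 8) with hδ
  have hδ0 : 0 < δ := by positivity
  refine ⟨ball z δ, mem_nhdsWithin_of_mem_nhds (ball_mem_nhds z hδ0), ?_⟩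
  filter_upwards [Metric.tendsto_nhds.1 (hf z hz) (ε / 3) (by positivity)] with n hn w hw
  have hwr : w ∈ ball z r := ball_subset_ball (min_le_left _ _) hw
  have hd : 2 / r * dist w z ≤ ε / 4 := by
    have h1 : dist w z ≤ r * ε / 8 := (le_of_lt hw).trans (min_le_right _ _)
    calc 2 / r * dist w z ≤ 2 / r * (r * ε / 8) := by gcongr
      _ = ε / 4 := by field_simp; norm_num
  have h1 := hlip n w hwr
  have h2 := hlipf w hwr
  have h3 := dist_triangle4 (f w) (f z) (F n z) (F n w)
  rw [dist_comm (f z) (F n z), dist_comm (F n z) (F n w)] at h3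
  linarith

/-- The derivative of a continuous square root. -/
lemma hasDerivAt_sqrt_branch {g F : ℂ → ℂ} {a F' : ℂ} (hg : ContinuousAt g a)
    (hF : HasDerivAt F F' a) (hgF : ∀ z, g z ^ 2 = F z) (ha : g a ≠ 0) :
    HasDerivAt g (F' / (2 * g a)) a := by
  rw [hasDerivAt_iff_tendsto_slope] at hF ⊢
  have h1 : Tendsto (fun z => g z + g a) (𝓝[≠] a) (𝓝 (2 * g a)) := by
    rw [two_mul]
    exact (hg.tendsto.mono_left nhdsWithin_le_nhds).add_const _
  have h2 : 2 * g a ≠ 0 := by simpa using ha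
  refine (hF.div h1 h2).congr' ?_
  filter_upwards [h1.eventually_ne h2] with z hz
  simp only [Pi.div_apply]
  rw [slope_def_field, slope_def_field, ← hgF, ← hgF]
  by_cases hza : z - a = 0
  · simp [hza]
  · field_simp
    ring

/-- Disc automorphism. -/
def mob (a z : ℂ) : ℂ := (z - a) / (1 - (starRingEnd ℂ) a * z)

lemma mob_den {a z : ℂ} (ha : ‖a‖ < 1) (hz : ‖z‖ < 1) : 1 - (starRingEnd ℂ) a * z ≠ 0 := by
  intro h
  have h1 : (starRingEnd ℂ) a * z = 1 := (sub_eq_zero.1 h).symm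
  have h2 : ‖a‖ * ‖z‖ = 1 := by
    rw [← Complex.norm_conj a, ← norm_mul, h1, norm_one]
  nlinarith [norm_nonneg a, norm_nonneg z]

lemma mob_norm {a z : ℂ} (ha : ‖a‖ < 1) (hz : ‖z‖ < 1) : ‖mob a z‖ < 1 := by
  rw [mob, norm_div, div_lt_one (norm_pos_iff.2 (mob_den ha hz))]
  apply lt_of_pow_lt_pow_left₀ 2 (norm_nonneg _)
  rw [← Complex.normSq_eq_norm_sq, ← Complex.normSq_eq_norm_sq]
  have h1 : Complex.normSq a < 1 := by
    rw [Complex.normSq_eq_norm_sq]; nlinarith [norm_nonneg a]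
  have h2 : Complex.normSq z < 1 := by
    rw [Complex.normSq_eq_norm_sq]; nlinarith [norm_nonneg z]
  rw [Complex.normSq_apply] at *
  rw [Complex.normSq_apply]
  simp
  nlinarith

lemma mob_inj {a z w : ℂ} (ha : ‖a‖ < 1) (hz : ‖z‖ < 1) (hw : ‖w‖ < 1)
    (h : mob a z = mob a w) : z = w := by
  rw [mob, mob, div_eq_div_iff (mob_den ha hz) (mob_den ha hw)] at h
  have h1 : (z - w) * (1 - (starRingEnd ℂ) a * a) = 0 := by linear_combination h
  rcases mul_eq_zero.1 h1 with h2 | h2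
  · exact sub_eq_zero.1 h2
  · exact absurd h2 (mob_den ha ha)

lemma mob_hasDerivAt {a z : ℂ} (ha : ‖a‖ < 1) (hz : ‖z‖ < 1) :
    HasDerivAt (mob a) ((1 - (starRingEnd ℂ) a * a) / (1 - (starRingEnd ℂ) a * z) ^ 2) z := by
  have h := ((hasDerivAt_id z).sub_const a).div
    (((hasDerivAt_id z).const_mul ((starRingEnd ℂ) a)).const_sub 1) (mob_den ha hz)
  refine h.congr_deriv ?_
  simp only [id]
  congr 1
  ring

/-- Class of competitors in the Riemann mapping theorem. -/
structure Comp (U : Set ℂ) (f : ℂ → ℂ) : Prop where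
  diff : DifferentiableOn ℂ f U
  inj : InjOn f U
  der : ∀ z ∈ U, deriv f z ≠ 0
  bd : ∀ z ∈ U, ‖f z‖ < 1
  zero : f 0 = 0

/-- Koebe's square root trick. -/
lemma koebe {U : Set ℂ} (hU : IsOpen U) (hUs : IsSimplyConnected U) (h0 : (0:ℂ) ∈ U)
    {f : ℂ → ℂ} (hf : Comp U f) {w : ℂ} (hw : ‖w‖ < 1) (hwf : w ∉ f '' U) :
    ∃ k, Comp U k ∧ ‖deriv f 0‖ < ‖deriv k 0‖ := by
  have hcont : ContinuousOn (fun z => mob w (f z)) U := by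
    intro z hz
    exact ((mob_hasDerivAt hw (hf.bd z hz)).continuousAt).comp_continuousWithinAt
      (hf.diff.continuousOn z hz)
  have hmw : ∀ z ∈ U, mob w (f z) ≠ 0 := by
    intro z hz h
    rw [mob, div_eq_zero_iff] at h
    rcases h with h | h
    · exact hwf ⟨z, hz, sub_eq_zero.1 h⟩
    · exact mob_den hw (hf.bd z hz) h
  obtain ⟨g, hgc, hg⟩ := Complex.exists_continuousOn_pow_eq hUs hU hcont
    (by rintro ⟨z, hz, h⟩; exact hmw z hz h) two_ne_zero
  have hg0 : ∀ z ∈ U, g z ≠ 0 := by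
    intro z hz h
    apply hmw z hz
    rw [← hg z, h]; simp
  have hg1 : ∀ z ∈ U, ‖g z‖ < 1 := by
    intro z hz
    have : ‖g z‖ ^ 2 < 1 := by
      rw [← norm_pow, hg z]; exact mob_norm hw (hf.bd z hz)
    nlinarith [norm_nonneg (g z)]
  have hfder : ∀ z ∈ U, HasDerivAt f (deriv f z) z := fun z hz =>
    (hf.diff.differentiableAt (hU.mem_nhds hz)).hasDerivAt
  have hgder : ∀ z ∈ U, HasDerivAt g ((1 - (starRingEnd ℂ) w * w) /
      (1 - (starRingEnd ℂ) w * f z) ^ 2 * deriv f z / (2 * g z)) z := fun z hz =>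
    hasDerivAt_sqrt_branch (hgc.continuousAt (hU.mem_nhds hz))
      ((mob_hasDerivAt hw (hf.bd z hz)).comp z (hfder z hz)) hg (hg0 z hz)
  have hkder : ∀ z ∈ U, HasDerivAt (fun z => mob (g 0) (g z))
      ((1 - (starRingEnd ℂ) (g 0) * (g 0)) / (1 - (starRingEnd ℂ) (g 0) * g z) ^ 2 *
      ((1 - (starRingEnd ℂ) w * w) /
      (1 - (starRingEnd ℂ) w * f z) ^ 2 * deriv f z / (2 * g z))) z := fun z hz =>
    (mob_hasDerivAt (hg1 0 h0) (hg1 z hz)).comp z (hgder z hz)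
  refine ⟨fun z => mob (g 0) (g z), ⟨?_, ?_, ?_, ?_, ?_⟩, ?_⟩
  · exact fun z hz => (hkder z hz).differentiableAt.differentiableWithinAt
  · intro z hz z' hz' h
    have h1 := mob_inj (hg1 0 h0) (hg1 z hz) (hg1 z' hz') h
    apply hf.inj hz hz'
    apply mob_inj hw (hf.bd z hz) (hf.bd z' hz')
    rw [← hg z, ← hg z', h1]
  · intro z hz
    rw [(hkder z hz).deriv]
    refine mul_ne_zero (div_ne_zero (mob_den (hg1 0 h0) (hg1 0 h0))
      (pow_ne_zero _ (mob_den (hg1 0 h0) (hg1 z hz)))) (div_ne_zero (mul_ne_zero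
      (div_ne_zero (mob_den hw hw) (pow_ne_zero _ (mob_den hw (hf.bd z hz)))) (hf.der z hz))
      (mul_ne_zero two_ne_zero (hg0 z hz)))
  · exact fun z hz => mob_norm (hg1 0 h0) (hg1 z hz)
  · simp [mob]
  · rw [(hkder 0 h0).deriv, hf.zero]
    have hcc : ∀ c : ℂ, (starRingEnd ℂ) c * c = ((‖c‖ ^ 2 : ℝ) : ℂ) := by
      intro c
      rw [mul_comm, Complex.mul_conj, Complex.normSq_eq_norm_sq]
    have hgw : ‖g 0‖ ^ 2 = ‖w‖ := by
      rw [← norm_pow, hg 0, hf.zero]; simp [mob]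
    set s := ‖g 0‖ with hs
    have hs0 : 0 < s := norm_pos_iff.2 (hg0 0 h0)
    have hs1 : s < 1 := hg1 0 h0
    have hd0 : 0 < ‖deriv f 0‖ := norm_pos_iff.2 (hf.der 0 h0)
    have hA : ‖(1:ℂ) - (starRingEnd ℂ) (g 0) * g 0‖ = 1 - s ^ 2 := by
      rw [hcc, ← hs, ← Complex.ofReal_one, ← Complex.ofReal_sub, Complex.norm_real,
        Real.norm_of_nonneg]
      nlinarith
    have hB : ‖(1:ℂ) - (starRingEnd ℂ) w * w‖ = 1 - s ^ 4 := by
      rw [hcc, ← hgw, ← Complex.ofReal_one, ← Complex.ofReal_sub, Complex.norm_real,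
        Real.norm_of_nonneg]
      · ring
      · have : s ^ 2 < 1 := by nlinarith
        nlinarith [sq_nonneg s]
    have hs2 : 0 < 1 - s ^ 2 := by nlinarith
    simp only [norm_mul, norm_div, norm_pow, hA, hB, mul_zero, sub_zero, one_pow,
      div_one, Complex.norm_ofNat, ← hs]
    have : (1 - s ^ 2) / (1 - s ^ 2) ^ 2 * ((1 - s ^ 4) * ‖deriv f 0‖ / (2 * s))
        = ‖deriv f 0‖ * ((1 + s ^ 2) / (2 * s)) := by
      field_simp
      ring
    rw [this]
    have h1 : 1 < (1 + s ^ 2) / (2 * s) := by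
      rw [one_lt_div (by positivity)]
      nlinarith [sq_nonneg (1 - s), mul_pos (sub_pos.2 hs1) (sub_pos.2 hs1)]
    nlinarith


theorem rmt {U : Set ℂ} (hU : IsOpen U) (hUs : IsSimplyConnected U) (h0 : (0:ℂ) ∈ U)
    (hUb : Bornology.IsBounded U) : ∃ f, Comp U f ∧ f '' U = ball 0 1 := by
  obtain ⟨R, hR0, hR⟩ := hUb.exists_pos_norm_lt
  have hconn : IsPreconnected U := hUs.isPathConnected.isConnected.isPreconnected
  have hbase : Comp U (fun z => (R:ℂ)⁻¹ * z) := by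
    have hR' : (R:ℂ)⁻¹ ≠ 0 := by simpa using hR0.ne'
    refine ⟨by fun_prop, fun z _ w _ h => mul_left_cancel₀ hR' h, ?_, ?_, by simp⟩
    · intro z _
      have : HasDerivAt (fun z => (R:ℂ)⁻¹ * z) ((R:ℂ)⁻¹ * 1) z := (hasDerivAt_id z).const_mul _
      rw [this.deriv]; simpa using hR0.ne'
    · intro z hz
      rw [norm_mul, norm_inv, Complex.norm_real, Real.norm_of_nonneg hR0.le,
        inv_mul_lt_iff₀ hR0]
      simpa using hR z hz
  obtain ⟨r, hr, hrU⟩ := Metric.isOpen_iff.1 hU 0 h0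
  set S : Set ℝ := {x | ∃ f, Comp U f ∧ x = ‖deriv f 0‖} with hS
  have hSne : S.Nonempty := ⟨_, _, hbase, rfl⟩
  have hSb : BddAbove S := by
    refine ⟨1 / r, ?_⟩
    rintro x ⟨f, hf, rfl⟩
    refine Complex.norm_deriv_le_div_of_mapsTo_ball (hf.diff.mono hrU) ?_ hr
    intro z hz
    rw [hf.zero]
    simpa using (hf.bd z (hrU hz)).le
  obtain ⟨u, -, hu, huS⟩ := exists_seq_tendsto_sSup hSne hSb
  choose F hF huF using huS
  set l : Ultrafilter ℕ := hyperfilter ℕ with hl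
  have hle : (l : Filter ℕ) ≤ atTop := Nat.hyperfilter_le_atTop
  obtain ⟨f, hf⟩ := montel l hU (fun n => (hF n).diff) (fun n z hz => ((hF n).bd z hz).le)
  have hfd : DifferentiableOn ℂ f U :=
    hf.differentiableOn (Eventually.of_forall fun n => (hF n).diff) hU
  have hder := hf.deriv (Eventually.of_forall fun n => (hF n).diff) hU
  have hd0 : ‖deriv f 0‖ = sSup S := by
    have h1 : Tendsto (fun n => ‖deriv (F n) 0‖) l (𝓝 ‖deriv f 0‖) :=
      (hder.tendsto_at h0).norm
    have h2 : Tendsto (fun n => ‖deriv (F n) 0‖) l (𝓝 (sSup S)) :=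
      (hu.mono_left hle).congr huF
    exact tendsto_nhds_unique h1 h2
  have hpos : deriv f 0 ≠ 0 := by
    rw [← norm_pos_iff, hd0]
    exact lt_of_lt_of_le (norm_pos_iff.2 (hbase.der 0 h0)) (le_csSup hSb ⟨_, hbase, rfl⟩)
  have han : AnalyticOnNhd ℂ f U := hfd.analyticOnNhd hU
  have hnc : ∀ c : ℂ, ∀ z ∈ U, ¬ ∀ᶠ w in 𝓝 z, f w - c = 0 := by
    intro c z hz hev
    have h1 : EqOn (fun w => f w - c) 0 U :=
      (han.sub analyticOnNhd_const).eqOn_zero_of_preconnected_of_eventuallyEq_zero hconn hz hev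
    apply hpos
    have h2 : f =ᶠ[𝓝 0] fun _ => c := by
      filter_upwards [hU.mem_nhds h0] with w hw
      exact sub_eq_zero.1 (h1 hw)
    rw [h2.deriv_eq]; simp
  have hcomp : Comp U f := by
    refine ⟨hfd, ?_, ?_, ?_, ?_⟩
    · intro a ha b hb hab
      by_contra hne
      have hVo : IsOpen (U \ {a}) := hU.sdiff isClosed_singleton
      have hlim : TendstoLocallyUniformlyOn (fun n z => F n z - F n a)
          (fun z => f z - f a) l (U \ {a}) := by
        rw [Metric.tendstoLocallyUniformlyOn_iff]
        intro ε hε x hx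
        obtain ⟨t, ht, h⟩ := Metric.tendstoLocallyUniformlyOn_iff.1 hf (ε / 2) (by positivity)
          x hx.1
        refine ⟨t, nhdsWithin_mono _ sdiff_subset ht, ?_⟩
        filter_upwards [h, Metric.tendsto_nhds.1 (hf.tendsto_at ha) (ε / 2) (by positivity)]
          with n hn1 hn2 y hy
        have h1 := hn1 y hy
        rw [dist_comm] at hn2
        calc dist (f y - f a) (F n y - F n a) ≤ dist (f y) (F n y) + dist (f a) (F n a) :=
              dist_sub_sub_le _ _ _ _
          _ < ε := by linarith
      refine hurwitz hVo (fun n => ((hF n).diff.mono sdiff_subset).sub_const _) hlim ?_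
        (b := b) ⟨hb, fun h => hne h.symm⟩ (hnc _ b hb) (sub_eq_zero.2 hab.symm)
      intro n z hz h
      exact hz.2 ((hF n).inj hz.1 ha (sub_eq_zero.1 h))
    · intro z hz
      refine hurwitz hU (fun n => ((hF n).diff.deriv hU)) hder (fun n => (hF n).der) hz ?_
      intro hev
      exact hpos ((han.deriv).eqOn_zero_of_preconnected_of_eventuallyEq_zero hconn hz hev h0)
    · have hop : IsOpen (f '' U) := by
        rcases han.is_constant_or_isOpen hconn with ⟨w, hw⟩ | h
        · exact absurd (by filter_upwards [hU.mem_nhds h0] with z hz; rw [hw z hz, sub_self])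
            (hnc w 0 h0)
        · exact h U subset_rfl hU
      have hsub : f '' U ⊆ closedBall 0 1 := by
        rintro _ ⟨z, hz, rfl⟩
        rw [mem_closedBall_zero_iff]
        exact le_of_tendsto (hf.tendsto_at hz).norm
          (Eventually.of_forall fun n => ((hF n).bd z hz).le)
      intro z hz
      have := interior_maximal hsub hop (mem_image_of_mem f hz)
      rw [interior_closedBall _ one_ne_zero] at this
      simpa using this
    · have h1 := hf.tendsto_at h0
      simp only [(hF _).zero] at h1
      exact tendsto_nhds_unique h1 tendsto_const_nhds
  refine ⟨f, hcomp, ?_⟩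
  apply Subset.antisymm
  · rintro _ ⟨z, hz, rfl⟩
    simpa using hcomp.bd z hz
  · intro w hw
    by_contra hwf
    obtain ⟨k, hk, hlt⟩ := koebe hU hUs h0 hcomp (by simpa using hw) hwf
    have := le_csSup hSb ⟨k, hk, rfl⟩
    rw [hd0] at hlt
    linarith

theorem rmt_inv {U : Set ℂ} (hU : IsOpen U) (hUs : IsSimplyConnected U) (h0 : (0:ℂ) ∈ U)
    (hUb : Bornology.IsBounded U) : ∃ φ ψ : ℂ → ℂ, ContinuousOn φ U ∧ MapsTo φ U (ball 0 1) ∧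
      DifferentiableOn ℂ ψ (ball 0 1) ∧ MapsTo ψ (ball 0 1) U ∧ (∀ z ∈ U, ψ (φ z) = z) ∧
      (∀ w ∈ ball (0:ℂ) 1, φ (ψ w) = w) ∧ ψ 0 = 0 ∧ deriv ψ 0 ≠ 0 := by
  obtain ⟨f, hf, hfU⟩ := rmt hU hUs h0 hUb
  set ψ := Function.invFunOn f U with hψ
  have hex : ∀ w ∈ ball (0:ℂ) 1, ∃ z ∈ U, f z = w := by
    intro w hw; rw [← hfU] at hw; exact hw
  have hmem : ∀ w ∈ ball (0:ℂ) 1, ψ w ∈ U := fun w hw => Function.invFunOn_mem (hex w hw)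
  have hr : ∀ w ∈ ball (0:ℂ) 1, f (ψ w) = w := fun w hw => Function.invFunOn_eq (hex w hw)
  have hmaps : MapsTo f U (ball 0 1) := fun z hz => by simpa using hf.bd z hz
  have hl : ∀ z ∈ U, ψ (f z) = z := fun z hz =>
    hf.inj (hmem _ (hmaps hz)) hz (hr _ (hmaps hz))
  have hcont : ∀ w ∈ ball (0:ℂ) 1, ContinuousAt ψ w := by
    intro w hw s hs
    have hs' : s ∩ U ∈ 𝓝 (ψ w) := inter_mem hs (hU.mem_nhds (hmem w hw))
    have hd : HasStrictDerivAt f (deriv f (ψ w)) (ψ w) :=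
      (hf.diff.analyticAt (hU.mem_nhds (hmem w hw))).hasStrictDerivAt
    have h1 : f '' (s ∩ U) ∈ 𝓝 w := by
      have := hd.map_nhds_eq (hf.der _ (hmem w hw))
      rw [hr w hw] at this
      rw [← this]
      exact image_mem_map hs'
    rw [mem_map]
    refine mem_of_superset h1 ?_
    rintro _ ⟨z, hz, rfl⟩
    rw [mem_preimage, hl z hz.2]
    exact hz.1
  have hder : ∀ w ∈ ball (0:ℂ) 1, HasDerivAt ψ (deriv f (ψ w))⁻¹ w := by
    intro w hw
    refine HasDerivAt.of_local_left_inverse (hcont w hw)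
      (hf.diff.differentiableAt (hU.mem_nhds (hmem w hw))).hasDerivAt (hf.der _ (hmem w hw)) ?_
    filter_upwards [isOpen_ball.mem_nhds hw] with y hy using hr y hy
  have h00 : (0:ℂ) ∈ ball (0:ℂ) 1 := mem_ball_self one_pos
  refine ⟨f, ψ, hf.diff.continuousOn, hmaps, ?_, hmem, hl, hr, ?_, ?_⟩
  · exact fun w hw => (hder w hw).differentiableAt.differentiableWithinAt
  · have := hl 0 h0
    rwa [hf.zero] at this
  · rw [(hder 0 h00).deriv]
    exact inv_ne_zero (hf.der _ (hmem _ h00))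

end AnnExt

namespace AnnExt

open Metric MeasureTheory

lemma area_lt_top {ψ : ℂ → ℂ} (hd : DifferentiableOn ℂ ψ (ball 0 1)) (hi : InjOn ψ (ball 0 1))
    (hb : Bornology.IsBounded (ψ '' ball 0 1)) :
    ∫⁻ z in ball (0:ℂ) 1, ‖deriv ψ z‖ₑ ^ 2 < ⊤ := by
  have hder : ∀ z ∈ ball (0:ℂ) 1, HasFDerivWithinAt ψ
      ((ContinuousLinearMap.toSpanSingleton ℂ (deriv ψ z)).restrictScalars ℝ)
      (ball 0 1) z := by
    intro z hz
    have h1 := (hd.differentiableAt (isOpen_ball.mem_nhds hz)).hasDerivAt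
    exact (h1.hasFDerivAt.restrictScalars ℝ).hasFDerivWithinAt
  have h := lintegral_image_eq_lintegral_abs_det_fderiv_mul volume
    (measurableSet_ball (x := (0:ℂ)) (ε := 1)) hder hi (fun _ => 1)
  have h2 : ∀ c : ℂ, ENNReal.ofReal
      |((ContinuousLinearMap.toSpanSingleton ℂ c).restrictScalars ℝ).det| = ‖c‖ₑ ^ 2 := by
    intro c
    have : ((ContinuousLinearMap.toSpanSingleton ℂ c).restrictScalars ℝ).det = ‖c‖ ^ 2 := by
      simp [ContinuousLinearMap.det, LinearMap.det_restrictScalars,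
        Algebra.norm_complex_apply, Complex.normSq_eq_norm_sq]
    rw [this, abs_of_nonneg (by positivity), ENNReal.ofReal_pow (norm_nonneg _),
      ofReal_norm]
  simp only [h2, mul_one, lintegral_one, Measure.restrict_apply MeasurableSet.univ,
    univ_inter] at h
  rw [← h]
  exact hb.measure_lt_top

/-- The estimate along an arc. -/
lemma arc_edist {ψ : ℂ → ℂ} (hd : DifferentiableOn ℂ ψ (ball 0 1)) {r a b : ℝ} (hr : 0 < r)
    (hab : a ≤ b) (ha : a ∈ Ioo (-Real.pi) Real.pi) (hb : b ∈ Ioo (-Real.pi) Real.pi)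
    (hin : ∀ θ ∈ Icc a b, (-1 + r * Complex.exp (θ * Complex.I) : ℂ) ∈ ball (0:ℂ) 1) :
    edist (ψ (-1 + r * Complex.exp (b * Complex.I))) (ψ (-1 + r * Complex.exp (a * Complex.I)))
    ≤ ENNReal.ofReal r * ∫⁻ θ in Ioo (-Real.pi) Real.pi, (ball (0:ℂ) 1).indicator
      (fun z => ‖deriv ψ z‖ₑ) (-1 + r * Complex.exp (θ * Complex.I)) := by
  set p : ℝ → ℂ := fun θ => -1 + r * Complex.exp (θ * Complex.I) with hp
  have hpd : ∀ θ : ℝ, HasDerivAt p (r * (Complex.exp (θ * Complex.I) * Complex.I)) θ := by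
    intro θ
    have h1 : HasDerivAt (fun θ : ℝ => (θ * Complex.I : ℂ)) (1 * Complex.I) θ :=
      (Complex.ofRealCLM.hasDerivAt (x := θ)).mul_const _
    have h2 := ((h1.cexp).const_mul (r : ℂ)).const_add (-1)
    rw [one_mul] at h2
    exact h2
  have hpc : Continuous p := by fun_prop
  have hder : ∀ θ ∈ uIcc a b, HasDerivAt (fun θ => ψ (p θ))
      (deriv ψ (p θ) * (r * (Complex.exp (θ * Complex.I) * Complex.I))) θ := by
    intro θ hθ
    rw [uIcc_of_le hab] at hθ
    exact (hd.differentiableAt (isOpen_ball.mem_nhds (hin θ hθ))).hasDerivAt.comp θ (hpd θ)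
  have hcont : ContinuousOn
      (fun θ : ℝ => deriv ψ (p θ) * (r * (Complex.exp (θ * Complex.I) * Complex.I)))
      (uIcc a b) := by
    rw [uIcc_of_le hab]
    refine ContinuousOn.mul ?_ (by fun_prop)
    exact ((hd.deriv isOpen_ball).continuousOn).comp hpc.continuousOn hin
  have hintegr := intervalIntegral.integral_eq_sub_of_hasDerivAt hder hcont.intervalIntegrable
  rw [intervalIntegral.integral_of_le hab] at hintegr
  rw [edist_eq_enorm_sub, ← hintegr]
  refine (enorm_integral_le_lintegral_enorm _).trans ?_
  rw [← lintegral_const_mul' _ _ ENNReal.ofReal_ne_top]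
  have hsub : Ioc a b ⊆ Ioo (-Real.pi) Real.pi := fun θ hθ =>
    ⟨ha.1.trans hθ.1, hθ.2.trans_lt hb.2⟩
  refine le_trans ?_ (lintegral_mono_set hsub)
  refine setLIntegral_mono' measurableSet_Ioc ?_
  intro θ hθ
  rw [indicator_of_mem (hin θ (Ioc_subset_Icc_self hθ))]
  rw [enorm_mul, enorm_mul, enorm_mul, mul_comm]
  have h1 : ‖Complex.exp (θ * Complex.I)‖ₑ = 1 := by
    rw [← ofReal_norm, Complex.norm_exp_ofReal_mul_I]; simp
  have h2 : ‖Complex.I‖ₑ = 1 := by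
    rw [← ofReal_norm, Complex.norm_I]; simp
  have h3 : ‖(r:ℂ)‖ₑ = ENNReal.ofReal r := by
    rw [← ofReal_norm, Complex.norm_real, Real.norm_of_nonneg hr.le]
  rw [h1, h2, h3, mul_one, mul_one]

lemma mem_disc_iff {r θ : ℝ} (hr : 0 < r) :
    (-1 + r * Complex.exp (θ * Complex.I) : ℂ) ∈ ball (0:ℂ) 1 ↔ r / 2 < Real.cos θ := by
  rw [mem_ball_zero_iff]
  have h : ‖(-1 + r * Complex.exp (θ * Complex.I) : ℂ)‖ ^ 2 = 1 - 2 * r * Real.cos θ + r ^ 2 := by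
    rw [← Complex.normSq_eq_norm_sq, Complex.normSq_apply, Complex.exp_mul_I]
    simp [← Complex.ofReal_cos, ← Complex.ofReal_sin]
    linear_combination r ^ 2 * Real.sin_sq_add_cos_sq θ
  constructor
  · intro h1
    have : ‖(-1 + r * Complex.exp (θ * Complex.I) : ℂ)‖ ^ 2 < 1 := by
      nlinarith [norm_nonneg (-1 + r * Complex.exp (θ * Complex.I) : ℂ)]
    rw [h] at this
    have h2 : r * (r - 2 * Real.cos θ) < 0 := by linarith
    have := neg_of_mul_neg_right h2 hr.le
    linarith
  · intro h1
    have : ‖(-1 + r * Complex.exp (θ * Complex.I) : ℂ)‖ ^ 2 < 1 := by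
      rw [h]; nlinarith
    nlinarith [norm_nonneg (-1 + r * Complex.exp (θ * Complex.I) : ℂ)]

lemma length_area_neg_one {ψ : ℂ → ℂ} (hd : DifferentiableOn ℂ ψ (ball 0 1))
    (hi : InjOn ψ (ball 0 1)) (hb : Bornology.IsBounded (ψ '' ball 0 1))
    {ε ρ : ℝ} (hε : 0 < ε) (hρ : 0 < ρ) :
    ∃ r ∈ Ioo 0 ρ, ∀ w ∈ ball (0:ℂ) 1, ∀ w' ∈ ball (0:ℂ) 1, dist w (-1) = r → dist w' (-1) = r →
      dist (ψ w) (ψ w') ≤ ε := by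
  by_contra hcon
  push Not at hcon
  set G : ℂ → ENNReal := (ball (0:ℂ) 1).indicator (fun z => ‖deriv ψ z‖ₑ) with hG
  have hGm : Measurable G := (measurable_deriv ψ).enorm.indicator measurableSet_ball
  set P : ℝ × ℝ → ℂ := fun x => -1 + x.1 * Complex.exp (x.2 * Complex.I) with hP
  have hPm : Measurable P := by
    have : Continuous P := by fun_prop
    exact this.measurable
  -- lower bound on each circle
  have hlow : ∀ r ∈ Ioo 0 ρ, ENNReal.ofReal (ε ^ 2 / (8 * Real.pi) * r⁻¹) ≤
      ∫⁻ θ in Ioo (-Real.pi) Real.pi, ENNReal.ofReal r * G (P (r, θ)) ^ 2 := by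
    intro r hr
    have hr0 : 0 < r := hr.1
    obtain ⟨w, hw, w', hw', hwr, hwr', hlt⟩ := hcon r hr
    have hangle : ∀ w ∈ ball (0:ℂ) 1, dist w (-1) = r → ∃ a ∈ Ioo (-Real.pi) Real.pi,
        w = -1 + r * Complex.exp (a * Complex.I) ∧ r / 2 < Real.cos a := by
      intro w hw hwr
      have h1 : w = -1 + r * Complex.exp (Complex.arg (w + 1) * Complex.I) := by
        have h2 : ‖w + 1‖ = r := by rw [← hwr, dist_eq_norm, sub_neg_eq_add]
        have := Complex.norm_mul_exp_arg_mul_I (w + 1)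
        rw [h2] at this
        rw [this]; ring
      have h3 : r / 2 < Real.cos (Complex.arg (w + 1)) := by
        rw [← mem_disc_iff hr0, ← h1]; exact hw
      refine ⟨Complex.arg (w + 1), ⟨Complex.neg_pi_lt_arg _, ?_⟩, h1, h3⟩
      refine lt_of_le_of_ne (Complex.arg_le_pi _) ?_
      intro h4
      rw [h4, Real.cos_pi] at h3
      linarith
    have key : ∀ a ∈ Ioo (-Real.pi) Real.pi, ∀ b ∈ Ioo (-Real.pi) Real.pi, a ≤ b →
        r / 2 < Real.cos a → r / 2 < Real.cos b →
        edist (ψ (-1 + r * Complex.exp (b * Complex.I)))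
          (ψ (-1 + r * Complex.exp (a * Complex.I)))
        ≤ ENNReal.ofReal r * ∫⁻ θ in Ioo (-Real.pi) Real.pi, G (P (r, θ)) := by
      intro a ha b hb hab hca hcb
      refine arc_edist hd hr0 hab ha hb ?_
      intro θ hθ
      rw [mem_disc_iff hr0]
      rw [← Real.cos_abs] at hca hcb ⊢
      rcases le_total |a| |b| with h | h
      · refine hcb.trans_le (Real.cos_le_cos_of_nonneg_of_le_pi (abs_nonneg _)
          (abs_le.2 ⟨hb.1.le, hb.2.le⟩) ?_)
        exact (abs_le_max_abs_abs hθ.1 hθ.2).trans (by rw [max_eq_right h])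
      · refine hca.trans_le (Real.cos_le_cos_of_nonneg_of_le_pi (abs_nonneg _)
          (abs_le.2 ⟨ha.1.le, ha.2.le⟩) ?_)
        exact (abs_le_max_abs_abs hθ.1 hθ.2).trans (by rw [max_eq_left h])
    have hlen : ENNReal.ofReal ε ≤
        ENNReal.ofReal r * ∫⁻ θ in Ioo (-Real.pi) Real.pi, G (P (r, θ)) := by
      obtain ⟨a, ha, hwa, hca⟩ := hangle w hw hwr
      obtain ⟨b, hb, hwb, hcb⟩ := hangle w' hw' hwr'
      have h1 : ENNReal.ofReal ε ≤ edist (ψ w) (ψ w') := by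
        rw [edist_dist]; exact ENNReal.ofReal_le_ofReal hlt.le
      refine h1.trans ?_
      rcases le_total a b with hab | hab
      · rw [edist_comm, hwa, hwb]; exact key a ha b hb hab hca hcb
      · rw [hwa, hwb]; exact key b hb a ha hab hcb hca
    set c : ℝ := ε / (4 * Real.pi * r) with hc
    have hpi := Real.pi_pos
    have hc0 : 0 < c := by positivity
    have hpt : ∀ x : ENNReal, ENNReal.ofReal c * x ≤ x ^ 2 + ENNReal.ofReal c ^ 2 := by
      intro x
      rcases le_total (ENNReal.ofReal c) x with h | h
      · calc ENNReal.ofReal c * x ≤ x * x := by gcongr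
          _ ≤ _ := by rw [sq x]; exact le_self_add
      · calc ENNReal.ofReal c * x ≤ ENNReal.ofReal c * ENNReal.ofReal c := by gcongr
          _ ≤ _ := by rw [sq (ENNReal.ofReal c)]; exact le_add_self
    have hI : ENNReal.ofReal c * ∫⁻ θ in Ioo (-Real.pi) Real.pi, G (P (r, θ)) ≤
        (∫⁻ θ in Ioo (-Real.pi) Real.pi, G (P (r, θ)) ^ 2)
          + ENNReal.ofReal c ^ 2 * ENNReal.ofReal (2 * Real.pi) := by
      rw [← lintegral_const_mul' _ _ ENNReal.ofReal_ne_top]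
      refine (lintegral_mono (fun θ => hpt _)).trans ?_
      rw [lintegral_add_right _ measurable_const]
      gcongr
      rw [setLIntegral_const, Real.volume_Ioo]
      gcongr
      linarith
    set A := ∫⁻ θ in Ioo (-Real.pi) Real.pi, G (P (r, θ)) ^ 2 with hA
    rw [lintegral_const_mul' _ _ ENNReal.ofReal_ne_top]
    change _ ≤ ENNReal.ofReal r * A
    by_cases hAt : A = ⊤
    · rw [hAt, ENNReal.mul_top (by simpa using hr0)]
      exact le_top
    obtain ⟨α, hα⟩ : ∃ α : ℝ, 0 ≤ α ∧ A = ENNReal.ofReal α :=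
      ⟨A.toReal, ENNReal.toReal_nonneg, (ENNReal.ofReal_toReal hAt).symm⟩
    have h1 : ENNReal.ofReal (c * ε) ≤ ENNReal.ofReal (r * (α + c ^ 2 * (2 * Real.pi))) := by
      rw [ENNReal.ofReal_mul hc0.le, ENNReal.ofReal_mul hr0.le,
        ENNReal.ofReal_add hα.1 (by positivity), ENNReal.ofReal_mul (by positivity),
        ENNReal.ofReal_pow hc0.le, ← hα.2]
      calc ENNReal.ofReal c * ENNReal.ofReal ε ≤ ENNReal.ofReal c * (ENNReal.ofReal r *
            ∫⁻ θ in Ioo (-Real.pi) Real.pi, G (P (r, θ))) := by gcongr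
        _ = ENNReal.ofReal r * (ENNReal.ofReal c *
            ∫⁻ θ in Ioo (-Real.pi) Real.pi, G (P (r, θ))) := by ring
        _ ≤ _ := by gcongr
    rw [hα.2, ← ENNReal.ofReal_mul hr0.le]
    apply ENNReal.ofReal_le_ofReal
    have h2 := (ENNReal.ofReal_le_ofReal_iff (by have := hα.1; positivity)).1 h1
    have h3 : r * (c ^ 2 * (2 * Real.pi)) = c * ε / 2 := by
      rw [hc]; field_simp; ring
    have h4 : ε ^ 2 / (8 * Real.pi) * r⁻¹ = c * ε / 2 := by
      rw [hc]; field_simp; ring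
    rw [h4]
    linarith
  -- integrate
  have htot : ∫⁻ r in Ioo 0 ρ, ENNReal.ofReal (ε ^ 2 / (8 * Real.pi) * r⁻¹) < ⊤ := by
    calc ∫⁻ r in Ioo 0 ρ, ENNReal.ofReal (ε ^ 2 / (8 * Real.pi) * r⁻¹)
        ≤ ∫⁻ r in Ioo 0 ρ, ∫⁻ θ in Ioo (-Real.pi) Real.pi,
          ENNReal.ofReal r * G (P (r, θ)) ^ 2 := setLIntegral_mono' measurableSet_Ioo hlow
      _ ≤ ∫⁻ r in Ioi 0, ∫⁻ θ in Ioo (-Real.pi) Real.pi,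
          ENNReal.ofReal r * G (P (r, θ)) ^ 2 := lintegral_mono_set Ioo_subset_Ioi_self
      _ = ∫⁻ x in (Ioi (0:ℝ)) ×ˢ Ioo (-Real.pi) Real.pi, ENNReal.ofReal x.1 * G (P x) ^ 2 := by
          rw [Measure.volume_eq_prod, ← Measure.prod_restrict, lintegral_prod]
          refine Measurable.aemeasurable ?_
          exact (measurable_fst.ennreal_ofReal).mul ((hGm.comp hPm).pow_const 2)
      _ = ∫⁻ z : ℂ, G (-1 + z) ^ 2 := by
          rw [← Complex.lintegral_comp_polarCoord_symm (fun z => G (-1 + z) ^ 2)]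
          rw [polarCoord_target]
          refine lintegral_congr fun x => ?_
          rw [smul_eq_mul, Complex.polarCoord_symm_apply]
          simp only [hP]
          rw [Complex.exp_mul_I]
          simp
      _ = ∫⁻ z : ℂ, G z ^ 2 := lintegral_add_left_eq_self (fun z => G z ^ 2) (-1)
      _ = ∫⁻ z in ball (0:ℂ) 1, ‖deriv ψ z‖ₑ ^ 2 := by
          rw [← lintegral_indicator measurableSet_ball]
          refine lintegral_congr fun z => ?_
          rw [hG]
          by_cases hz : z ∈ ball (0:ℂ) 1
          · rw [indicator_of_mem hz, indicator_of_mem hz]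
          · rw [indicator_of_notMem hz, indicator_of_notMem hz]; simp
      _ < ⊤ := area_lt_top hd hi hb
  have hpi := Real.pi_pos
  have hintegr : IntegrableOn (fun r : ℝ => ε ^ 2 / (8 * Real.pi) * r⁻¹) (Ioo 0 ρ) := by
    refine ⟨(measurable_inv.const_mul _).aestronglyMeasurable, ?_⟩
    rw [hasFiniteIntegral_iff_ofReal]
    · exact htot
    · filter_upwards [ae_restrict_mem measurableSet_Ioo] with r hr
      have : 0 < r := hr.1
      simp only [Pi.zero_apply]
      positivity
  have hint2 : IntervalIntegrable (fun r : ℝ => r⁻¹) volume 0 ρ := by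
    rw [intervalIntegrable_iff_integrableOn_Ioo_of_le hρ.le]
    have := hintegr.const_mul (ε ^ 2 / (8 * Real.pi))⁻¹
    refine this.congr ?_
    refine Eventually.of_forall fun r => ?_
    simp only
    rw [← mul_assoc, inv_mul_cancel₀ (by positivity), one_mul]
  rw [intervalIntegrable_inv_iff] at hint2
  rcases hint2 with h | h
  · exact hρ.ne h
  · exact h (by simp)

lemma length_area {ψ : ℂ → ℂ} (hd : DifferentiableOn ℂ ψ (ball 0 1))
    (hi : InjOn ψ (ball 0 1)) (hb : Bornology.IsBounded (ψ '' ball 0 1)) {ζ : ℂ} (hζ : ‖ζ‖ = 1)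
    {ε ρ : ℝ} (hε : 0 < ε) (hρ : 0 < ρ) :
    ∃ r ∈ Ioo 0 ρ, ∀ w ∈ ball (0:ℂ) 1, ∀ w' ∈ ball (0:ℂ) 1, dist w ζ = r → dist w' ζ = r →
      dist (ψ w) (ψ w') ≤ ε := by
  have hζ0 : ζ ≠ 0 := by rw [← norm_pos_iff, hζ]; exact one_pos
  have hmaps : MapsTo (fun w : ℂ => -ζ * w) (ball 0 1) (ball 0 1) := by
    intro w hw
    simpa [hζ] using hw
  have hinj : Function.Injective (fun w : ℂ => -ζ * w) :=
    mul_right_injective₀ (neg_ne_zero.2 hζ0)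
  obtain ⟨r, hr, h⟩ := length_area_neg_one (ψ := fun w => ψ (-ζ * w))
    (hd.comp (by fun_prop) hmaps) (hi.comp hinj.injOn hmaps)
    (hb.subset (by rintro _ ⟨w, hw, rfl⟩; exact ⟨_, hmaps hw, rfl⟩)) hε hρ
  refine ⟨r, hr, fun w hw w' hw' hwr hwr' => ?_⟩
  have hin : ∀ w : ℂ, -ζ * (-ζ⁻¹ * w) = w := by intro w; field_simp
  have hball : ∀ w ∈ ball (0:ℂ) 1, -ζ⁻¹ * w ∈ ball (0:ℂ) 1 := by
    intro w hw; simpa [hζ] using hw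
  have hdist : ∀ w : ℂ, dist (-ζ⁻¹ * w) (-1) = dist w ζ := by
    intro w
    have : -ζ⁻¹ * w - -1 = -ζ⁻¹ * (w - ζ) := by field_simp; ring
    rw [dist_eq_norm, this, norm_mul, norm_neg, norm_inv, hζ, dist_eq_norm]; simp
  have := h _ (hball w hw) _ (hball w' hw') (by rw [hdist, hwr]) (by rw [hdist, hwr'])
  simpa only [hin] using this

end AnnExt

namespace AnnExt
open Metric

/-- A pair of mutually inverse continuous self-maps of the open unit disc fixing zero. -/
structure DiscHomeo (V W : ℂ → ℂ) : Prop where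
  Vm : MapsTo V (ball 0 1) (ball 0 1)
  Wm : MapsTo W (ball 0 1) (ball 0 1)
  Vc : ContinuousOn V (ball 0 1)
  Wc : ContinuousOn W (ball 0 1)
  WV : ∀ w ∈ ball (0:ℂ) 1, W (V w) = w
  VW : ∀ w ∈ ball (0:ℂ) 1, V (W w) = w
  V0 : V 0 = 0

/-- The crosscut property. -/
def Cross (V : ℂ → ℂ) : Prop := ∀ ζ : ℂ, ‖ζ‖ = 1 → ∀ ε > 0, ∀ ρ > 0, ∃ r ∈ Ioo (0:ℝ) ρ,
  ∀ w ∈ ball (0:ℂ) 1, ∀ w' ∈ ball (0:ℂ) 1, dist w ζ = r → dist w' ζ = r →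
    dist (V w) (V w') ≤ ε

lemma zero_mem_B : (0:ℂ) ∈ ball (0:ℂ) 1 := mem_ball_self one_pos

lemma DiscHomeo.W0 {V W : ℂ → ℂ} (h : DiscHomeo V W) : W 0 = 0 := by
  have := h.WV 0 zero_mem_B
  rwa [h.V0] at this

lemma DiscHomeo.near {V W : ℂ → ℂ} (h : DiscHomeo V W) {ζ : ℂ} (hζ : ‖ζ‖ = 1) {m : ℝ}
    (hm : m < 1) : ∃ ρ > 0, ∀ w ∈ ball (0:ℂ) 1, dist w ζ < ρ → m < ‖V w‖ := by
  have hsub : closedBall (0:ℂ) m ⊆ ball 0 1 := closedBall_subset_ball hm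
  have hC : IsCompact (W '' closedBall 0 m) :=
    (isCompact_closedBall 0 m).image_of_continuousOn (h.Wc.mono hsub)
  have hζC : ζ ∈ (W '' closedBall 0 m)ᶜ := by
    rintro ⟨u, hu, rfl⟩
    have := h.Wm (hsub hu)
    rw [mem_ball_zero_iff] at this
    linarith
  obtain ⟨ρ, hρ, hb⟩ := Metric.isOpen_iff.1 hC.isClosed.isOpen_compl ζ hζC
  refine ⟨ρ, hρ, fun w hw hd => ?_⟩
  by_contra hcon
  push Not at hcon
  refine hb (mem_ball.2 hd) ⟨V w, ?_, h.WV w hw⟩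
  rwa [mem_closedBall_zero_iff]

lemma DiscHomeo.cap {V W : ℂ → ℂ} (h : DiscHomeo V W) (hX : Cross V) {ζ : ℂ} (hζ : ‖ζ‖ = 1)
    {ε : ℝ} (hε : 0 < ε) : ∃ r > 0, ∀ w ∈ ball (0:ℂ) 1, ∀ w' ∈ ball (0:ℂ) 1,
      dist w ζ < r → dist w' ζ < r → dist (V w) (V w') < ε := by
  set η : ℝ := min (1/2) (ε^2/8) with hη
  have hη0 : 0 < η := by positivity
  have hη1 : η ≤ 1/2 := min_le_left _ _
  have hη2 : η ≤ ε^2/8 := min_le_right _ _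
  obtain ⟨ρ, hρ, hnear⟩ := h.near hζ (m := 1 - η/2) (by linarith)
  obtain ⟨r, ⟨hr0, hr1⟩, hr⟩ := hX ζ hζ (η/2) (by positivity) (min ρ 1) (by positivity)
  have hrρ : r < ρ := hr1.trans_le (min_le_left _ _)
  have hr1' : r < 1 := hr1.trans_le (min_le_right _ _)
  set w1 : ℂ := ((1 - r : ℝ) : ℂ) * ζ with hw1
  have hw1B : w1 ∈ ball (0:ℂ) 1 := by
    rw [mem_ball_zero_iff, hw1, norm_mul, hζ, Complex.norm_real, Real.norm_eq_abs,
      abs_of_pos (by linarith)]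
    linarith
  have hw1d : dist w1 ζ = r := by
    rw [dist_eq_norm, show w1 - ζ = ((-r : ℝ) : ℂ) * ζ by rw [hw1]; push_cast; ring, norm_mul, hζ,
      Complex.norm_real, Real.norm_eq_abs, abs_neg, abs_of_pos hr0, mul_one]
  set u1 := V w1 with hu1
  have hu1n : 1 - η/2 < ‖u1‖ := hnear w1 hw1B (by rw [hw1d]; exact hrρ)
  have hu1p : 0 < ‖u1‖ := by linarith
  set q : ℂ := (‖u1‖⁻¹ : ℝ) • u1 with hq
  have hqn : ‖q‖ = 1 := by
    rw [hq, norm_smul, norm_inv, norm_norm, inv_mul_cancel₀ hu1p.ne']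
  have hqu1 : inner ℝ q u1 = ‖u1‖ := by
    rw [hq, real_inner_smul_left, real_inner_self_eq_norm_sq]
    field_simp
  have harc : ∀ w ∈ ball (0:ℂ) 1, dist w ζ = r → 1 - η < inner ℝ q (V w) := by
    intro w hw hd
    have h1 := hr w hw w1 hw1B hd hw1d
    have h2 : inner ℝ q (V w) = inner ℝ q u1 + inner ℝ q (V w - u1) := by
      rw [inner_sub_right]; ring
    have h3 : |inner ℝ q (V w - u1)| ≤ ‖q‖ * ‖V w - u1‖ := abs_real_inner_le_norm _ _
    rw [hqn, one_mul, ← dist_eq_norm] at h3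
    have := (abs_le.1 h3).1
    rw [h2, hqu1]
    linarith
  have hin : ∀ w ∈ ball (0:ℂ) 1, dist w ζ < r → 1 - η < inner ℝ q (V w) := by
    intro w hw hd
    by_contra hcon
    push Not at hcon
    set D : Set ℂ := ball 0 1 ∩ {u | inner ℝ q u ≤ 1 - η} with hD
    have hDc : Convex ℝ D := by
      refine (convex_ball _ _).inter ?_
      exact convex_halfSpace_le (f := fun u => inner ℝ q u)
        (IsLinearMap.mk (fun x y => inner_add_right _ _ _)
          (fun c x => by rw [real_inner_smul_right]; rfl)) _
    have hpc : IsPreconnected ((fun u => dist (W u) ζ) '' D) := by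
      refine hDc.isPreconnected.image _ ?_
      have hWD : ContinuousOn W D := h.Wc.mono inter_subset_left
      exact (continuous_id.dist continuous_const).comp_continuousOn hWD
    have h0 : (1:ℝ) ∈ (fun u => dist (W u) ζ) '' D := by
      refine ⟨0, ⟨zero_mem_B, by simp; linarith⟩, ?_⟩
      simp [h.W0, hζ]
    have h1 : dist w ζ ∈ (fun u => dist (W u) ζ) '' D :=
      ⟨V w, ⟨h.Vm hw, hcon⟩, by simp only [h.WV w hw]⟩
    obtain ⟨u, hu, hur⟩ := hpc.Icc_subset h1 h0 ⟨hd.le, hr1'.le⟩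
    have := harc (W u) (h.Wm hu.1) hur
    rw [h.VW u hu.1] at this
    have h2 : inner ℝ q u ≤ 1 - η := hu.2
    linarith
  have hq2 : ∀ w ∈ ball (0:ℂ) 1, dist w ζ < r → dist (V w) q < ε / 2 := by
    intro w hw hd
    have h1 := hin w hw hd
    have h2 : ‖V w‖ < 1 := by simpa using h.Vm hw
    rw [dist_eq_norm]
    refine lt_of_pow_lt_pow_left₀ 2 (by positivity) ?_
    rw [norm_sub_sq_real, real_inner_comm, hqn]
    nlinarith [norm_nonneg (V w)]
  refine ⟨r, hr0, fun w hw w' hw' hd hd' => ?_⟩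
  calc dist (V w) (V w') ≤ dist (V w) q + dist (V w') q := dist_triangle_right _ _ _
    _ < ε := by linarith [hq2 w hw hd, hq2 w' hw' hd']

lemma DiscHomeo.tendsto {V W : ℂ → ℂ} (h : DiscHomeo V W) (hX : Cross V) {ζ : ℂ}
    (hζ : ζ ∈ closedBall (0:ℂ) 1) : ∃ p, Tendsto V (𝓝[ball 0 1] ζ) (𝓝 p) := by
  by_cases hζB : ζ ∈ ball (0:ℂ) 1
  · exact ⟨_, h.Vc ζ hζB⟩
  have hζ1 : ‖ζ‖ = 1 := by
    rw [mem_closedBall_zero_iff] at hζ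
    rw [mem_ball_zero_iff] at hζB
    linarith
  have hcl : ζ ∈ closure (ball (0:ℂ) 1) := by rwa [closure_ball _ one_ne_zero]
  have : (𝓝[ball 0 1] ζ).NeBot := mem_closure_iff_nhdsWithin_neBot.1 hcl
  have : Cauchy (map V (𝓝[ball 0 1] ζ)) := by
    rw [Metric.cauchy_iff]
    refine ⟨inferInstance, fun ε hε => ?_⟩
    obtain ⟨r, hr, hw⟩ := h.cap hX hζ1 hε
    refine ⟨V '' (ball 0 1 ∩ ball ζ r), image_mem_map ?_, ?_⟩
    · exact inter_mem self_mem_nhdsWithin (mem_nhdsWithin_of_mem_nhds (ball_mem_nhds _ hr))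
    · rintro _ ⟨w, hw1, rfl⟩ _ ⟨w', hw2, rfl⟩
      exact hw w hw1.1 w' hw2.1 hw1.2 hw2.2
  exact CompleteSpace.complete this

lemma DiscHomeo.extend {V W : ℂ → ℂ} (h : DiscHomeo V W) (hX : Cross V) :
    ∃ Vb : ℂ → ℂ, ContinuousOn Vb (closedBall 0 1) ∧ (∀ w ∈ ball (0:ℂ) 1, Vb w = V w) ∧
      (∀ w, ‖w‖ = 1 → ‖Vb w‖ = 1) ∧ SurjOn Vb (closedBall 0 1) (closedBall 0 1) := by
  have hcl : closure (ball (0:ℂ) 1) = closedBall 0 1 := closure_ball _ one_ne_zero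
  have hc : ContinuousOn (extendFrom (ball 0 1) V) (closedBall 0 1) :=
    continuousOn_extendFrom hcl.ge (fun x hx => h.tendsto hX hx)
  have heq : ∀ w ∈ ball (0:ℂ) 1, extendFrom (ball 0 1) V w = V w := fun w hw =>
    extendFrom_eq (subset_closure hw) (h.Vc w hw)
  have hlim : ∀ w, ‖w‖ = 1 → Tendsto V (𝓝[ball 0 1] w) (𝓝 (extendFrom (ball 0 1) V w)) :=
    fun w hw => tendsto_extendFrom (h.tendsto hX (by rw [mem_closedBall_zero_iff, hw]))
  refine ⟨extendFrom (ball 0 1) V, hc, heq, fun w hw => ?_, ?_⟩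
  · have hwcl : w ∈ closure (ball (0:ℂ) 1) := by rw [hcl, mem_closedBall_zero_iff, hw]
    have : (𝓝[ball 0 1] w).NeBot := mem_closure_iff_nhdsWithin_neBot.1 hwcl
    have hl := (hlim w hw).norm
    apply le_antisymm
    · refine le_of_tendsto hl ?_
      filter_upwards [self_mem_nhdsWithin] with z hz
      have := h.Vm hz
      rw [mem_ball_zero_iff] at this
      exact this.le
    · refine le_of_forall_lt fun m hm => ?_
      obtain ⟨m', hm', hm1⟩ := exists_between hm
      refine hm'.trans_le ?_
      obtain ⟨ρ, hρ, hn⟩ := h.near hw hm1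
      refine ge_of_tendsto hl ?_
      filter_upwards [self_mem_nhdsWithin, mem_nhdsWithin_of_mem_nhds (ball_mem_nhds w hρ)]
        with z hz hz'
      exact (hn z hz hz').le
  · have hcomp : IsCompact (extendFrom (ball 0 1) V '' closedBall 0 1) :=
      (isCompact_closedBall _ _).image_of_continuousOn hc
    have : closure (ball (0:ℂ) 1) ⊆ extendFrom (ball 0 1) V '' closedBall 0 1 := by
      refine closure_minimal ?_ hcomp.isClosed
      intro u hu
      exact ⟨W u, ball_subset_closedBall (h.Wm hu), by rw [heq _ (h.Wm hu), h.VW u hu]⟩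
    rwa [hcl] at this

lemma const_arc {f : ℂ → ℂ} (hf : DiffContOnCl ℂ f (ball 0 1)) {O : Set ℂ} (hO : IsOpen O)
    {ξ : ℂ} (hξ : ‖ξ‖ = 1) (hξO : ξ ∈ O) (h : ∀ z ∈ O, ‖z‖ = 1 → f z = 0) : f 0 = 0 := by
  have hcov : sphere (0:ℂ) 1 ⊆ ⋃ c : sphere (0:ℂ) 1, {w : ℂ | (c:ℂ) * w ∈ O} := by
    intro w hw
    have hw1 : ‖w‖ = 1 := by simpa using hw
    have hw0 : w ≠ 0 := by rintro rfl; simp at hw1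
    refine mem_iUnion.2 ⟨⟨ξ / w, by simp [hξ, hw1]⟩, ?_⟩
    simp [hw0, hξO]
  obtain ⟨t, ht⟩ := (isCompact_sphere (0:ℂ) 1).elim_finite_subcover _
    (fun c => hO.preimage (by fun_prop)) hcov
  set G : ℂ → ℂ := fun w => ∏ c ∈ t, f ((c:ℂ) * w) with hG
  have hcn : ∀ c : sphere (0:ℂ) 1, ‖(c:ℂ)‖ = 1 := fun c => by simpa using c.2
  have hGd : DiffContOnCl ℂ G (ball 0 1) := by
    constructor
    · refine DifferentiableOn.fun_finsetProd fun c _ => ?_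
      refine hf.1.comp (by fun_prop) ?_
      intro w hw
      simpa [hcn] using hw
    · refine continuousOn_finsetProd _ fun c _ => ?_
      refine hf.2.comp (by fun_prop) ?_
      rw [closure_ball _ one_ne_zero]
      intro w hw
      simpa [hcn] using hw
  have := Complex.norm_le_of_forall_mem_frontier_norm_le isBounded_ball hGd (C := 0) ?_
    (subset_closure zero_mem_B)
  · have h0 : G 0 = 0 := by simpa using this
    rw [hG] at h0
    obtain ⟨c, -, hc⟩ := Finset.prod_eq_zero_iff.1 h0
    simpa using hc
  · intro z hz
    rw [frontier_ball _ one_ne_zero] at hz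
    obtain ⟨c, hc⟩ := mem_iUnion.1 (ht hz)
    obtain ⟨hct, hc⟩ := mem_iUnion.1 hc
    have hz1 : ‖z‖ = 1 := by simpa using hz
    rw [norm_le_zero_iff]
    refine Finset.prod_eq_zero hct (h _ hc ?_)
    rw [norm_mul, hcn, hz1, one_mul]

end AnnExt

namespace AnnExt
open Metric

lemma exists_unit_pos {n ζ1 ζ2 : ℂ} (hn : n ≠ 0) (h1 : ‖ζ1‖ = 1) (h2 : ‖ζ2‖ = 1) (hne : ζ1 ≠ ζ2)
    (ho : inner ℝ n (ζ2 - ζ1) = 0) : ∃ ξ : ℂ, ‖ξ‖ = 1 ∧ 0 < inner ℝ n (ξ - ζ1) := by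
  have hn0 : 0 < ‖n‖ := norm_pos_iff.2 hn
  refine ⟨(‖n‖⁻¹ : ℝ) • n, ?_, ?_⟩
  · rw [norm_smul, norm_inv, norm_norm, inv_mul_cancel₀ hn0.ne']
  · rw [inner_sub_right, real_inner_smul_right, real_inner_self_eq_norm_sq]
    have e : ‖n‖⁻¹ * ‖n‖ ^ 2 = ‖n‖ := by field_simp
    rw [e]
    rw [inner_sub_right] at ho
    by_contra hcon
    have h3 : inner ℝ n ζ1 ≤ ‖n‖ * ‖ζ1‖ := real_inner_le_norm _ _
    have h4 : inner ℝ n ζ1 = ‖n‖ * ‖ζ1‖ := by rw [h1] at h3 ⊢; linarith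
    have h5 : inner ℝ n ζ2 = ‖n‖ * ‖ζ2‖ := by rw [h1] at h4; rw [h2]; linarith
    rw [inner_eq_norm_mul_iff_real, h1] at h4
    rw [inner_eq_norm_mul_iff_real, h2, h4] at h5
    exact hne (smul_right_injective ℂ hn0.ne' h5)

lemma chord_circle {ζ1 ζ2 w : ℂ} (h1 : ‖ζ1‖ = 1) (h2 : ‖ζ2‖ = 1) (hw : ‖w‖ = 1)
    (hne : ζ1 ≠ ζ2) (hl : inner ℝ (Complex.I * (ζ2 - ζ1)) (w - ζ1) = 0) : w = ζ1 ∨ w = ζ2 := by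
  have e : ∀ z : ℂ, ‖z‖ = 1 → z.re * z.re + z.im * z.im = 1 := by
    intro z hz
    rw [← Complex.normSq_apply, Complex.normSq_eq_norm_sq, hz, one_pow]
  have a1 := e _ h1
  have a2 := e _ h2
  have a3 := e _ hw
  simp [Complex.inner] at hl
  have key : ((ζ1.re - ζ2.re)^2 + (ζ1.im - ζ2.im)^2) * (((w.re - ζ1.re)^2 + (w.im - ζ1.im)^2) *
      ((w.re - ζ2.re)^2 + (w.im - ζ2.im)^2)) = 0 := by
    clear e
    generalize w.re = x at *
    generalize w.im = y at *
    generalize ζ1.re = x1 at *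
    generalize ζ1.im = y1 at *
    generalize ζ2.re = x2 at *
    generalize ζ2.im = y2 at *
    have h : ((x1 - x2)^2 + (y1 - y2)^2) * (((x - x1)^2 + (y - y1)^2) *
      ((x - x2)^2 + (y - y2)^2)) = 4 * ((y - y1) * (x2 - x1) - (x - x1) * (-y1 + y2)) ^ 2 := by
      grind
    rw [h, hl]; ring
  have hz : ∀ a b : ℂ, (a.re - b.re)^2 + (a.im - b.im)^2 = 0 → a = b := by
    intro a b h
    have ha := sq_nonneg (a.re - b.re)
    have hb := sq_nonneg (a.im - b.im)
    apply Complex.ext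
    · exact sub_eq_zero.1 (pow_eq_zero_iff two_ne_zero |>.1 (le_antisymm (by linarith) ha))
    · exact sub_eq_zero.1 (pow_eq_zero_iff two_ne_zero |>.1 (le_antisymm (by linarith) hb))
  rcases mul_eq_zero.1 key with h | h
  · exact absurd (hz _ _ h) hne
  rcases mul_eq_zero.1 h with h | h
  · exact Or.inl (hz _ _ h)
  · exact Or.inr (hz _ _ h)

/-- Sector separation: two boundary points on different sides of the chord. -/
lemma DiscHomeo.sides {V W Vb : ℂ → ℂ} (h : DiscHomeo V W)
    (hc : ContinuousOn Vb (closedBall 0 1)) (hV : ∀ w ∈ ball (0:ℂ) 1, Vb w = V w)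
    (hS : ∀ w, ‖w‖ = 1 → ‖Vb w‖ = 1) {ζ1 ζ2 p : ℂ} (h1 : ‖ζ1‖ = 1) (h2 : ‖ζ2‖ = 1)
    (hne : ζ1 ≠ ζ2) (hp1 : Vb ζ1 = p) (hp2 : Vb ζ2 = p) {ξ1 ξ2 : ℂ} (hξ1 : ‖ξ1‖ = 1)
    (hξ2 : ‖ξ2‖ = 1) (hl1 : 0 < inner ℝ (Complex.I * (ζ2 - ζ1)) (ξ1 - ζ1))
    (hl2 : inner ℝ (Complex.I * (ζ2 - ζ1)) (ξ2 - ζ1) < 0) (hq1 : Vb ξ1 ≠ p) (hq2 : Vb ξ2 ≠ p) :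
    False := by
  set n := Complex.I * (ζ2 - ζ1) with hn
  set l : ℂ → ℝ := fun w => inner ℝ n (w - ζ1) with hl
  have hlc : Continuous l := by fun_prop
  have hpn : ‖p‖ = 1 := by rw [← hp1]; exact hS _ h1
  have hp0 : p ≠ 0 := by rintro rfl; simp at hpn
  set J : Set ℂ := Vb '' (closedBall 0 1 ∩ {w | l w = 0}) with hJ
  have hJc : IsCompact J := by
    refine IsCompact.image_of_continuousOn ?_ (hc.mono inter_subset_left)
    exact (isCompact_closedBall _ _).inter_right (isClosed_eq hlc continuous_const)
  have hJp : ∀ u ∈ J, ‖u‖ = 1 → u = p := by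
    rintro _ ⟨w, ⟨hw, hw0⟩, rfl⟩ hu
    have hw1 : ‖w‖ = 1 := by
      by_contra hcon
      have hwB : w ∈ ball (0:ℂ) 1 := by
        rw [mem_ball_zero_iff]
        rw [mem_closedBall_zero_iff] at hw
        exact lt_of_le_of_ne hw hcon
      rw [hV w hwB] at hu
      have := h.Vm hwB
      rw [mem_ball_zero_iff] at this
      linarith
    rcases chord_circle h1 h2 hw1 hne hw0 with rfl | rfl
    · exact hp1
    · exact hp2
  -- arguments
  have harg : ∀ u : ℂ, ‖u‖ = 1 → u ≠ p → -u / p ∈ Complex.slitPlane := by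
    intro u hu hup
    rw [Complex.mem_slitPlane_iff_arg]
    have hne0 : -u / p ≠ 0 := by
      have : u ≠ 0 := by rintro rfl; simp at hu
      simp [this, hp0]
    refine ⟨fun hpi => hup ?_, hne0⟩
    have h3 := Complex.norm_mul_exp_arg_mul_I (-u / p)
    rw [hpi, Complex.exp_pi_mul_I, norm_div, norm_neg, hu, hpn] at h3
    simp only [div_one, Complex.ofReal_one, mul_neg, mul_one] at h3
    field_simp at h3
    have : -p = -u := by linear_combination h3
    exact (neg_injective this).symm
  have hargpi : ∀ u : ℂ, ‖u‖ = 1 → u ≠ p → |(-u / p).arg| < Real.pi := by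
    intro u hu hup
    have h3 := harg u hu hup
    rw [Complex.mem_slitPlane_iff_arg] at h3
    rw [abs_lt]
    exact ⟨Complex.neg_pi_lt_arg _, lt_of_le_of_ne (Complex.arg_le_pi _) h3.1⟩
  have hk1 := hargpi _ (hS _ hξ1) hq1
  have hk2 := hargpi _ (hS _ hξ2) hq2
  obtain ⟨κ, hκ, hκpi⟩ := exists_between (max_lt hk1 hk2)
  have hκ1 := (le_max_left _ _).trans_lt hκ
  have hκ2 := (le_max_right _ _).trans_lt hκ
  set P : ℝ × ℝ → ℂ := fun x => -p * (x.1 * Complex.exp (x.2 * Complex.I)) with hP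
  have hPc : Continuous P := by fun_prop
  have hPn : ∀ x : ℝ × ℝ, 0 ≤ x.1 → ‖P x‖ = x.1 := by
    intro x hx
    rw [hP]
    simp [hpn, Complex.norm_exp_ofReal_mul_I, abs_of_nonneg hx]
  -- the thickening
  obtain ⟨ρ, hρ1, hρ0, hρ⟩ : ∃ ρ : ℝ, ρ < 1 ∧ 0 < ρ ∧ ∀ s ∈ Ioo ρ 1, ∀ a ∈ Ioo (-κ) κ,
      P (s, a) ∉ J := by
    set M : Set (ℝ × ℝ) := (Icc 0 1 ×ˢ Icc (-κ) κ) ∩ P ⁻¹' J with hM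
    have hMc : IsCompact M :=
      (isCompact_Icc.prod isCompact_Icc).inter_right (hJc.isClosed.preimage hPc)
    have hM1 : (1:ℝ) ∈ (Prod.fst '' M)ᶜ := by
      rintro ⟨⟨s, a⟩, ⟨⟨hs, ha⟩, hm⟩, hs1⟩
      simp only at hs1 ha
      subst hs1
      have h3 := hJp _ hm (hPn _ zero_le_one)
      have h4 : Complex.exp (a * Complex.I) = -1 := by
        have h5 : -p * ((1:ℝ) * Complex.exp (a * Complex.I)) = p := h3
        have h6 : p * (Complex.exp (a * Complex.I) + 1) = 0 := by
          push_cast at h5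
          linear_combination -h5
        rcases mul_eq_zero.1 h6 with h7 | h7
        · exact absurd h7 hp0
        · linear_combination h7
      have h5 := congrArg Complex.re h4
      rw [Complex.exp_ofReal_mul_I_re] at h5
      have h6 : 0 < 1 + Real.cos a := by
        have h7 := Real.cos_pos_of_mem_Ioo (x := a / 2) ⟨by linarith [ha.1], by linarith [ha.2]⟩
        have h8 := Real.cos_sq (a / 2)
        rw [show 2 * (a / 2) = a by ring] at h8
        nlinarith
      simp at h5
      linarith
    have hop : IsOpen (Prod.fst '' M)ᶜ := (hMc.image continuous_fst).isClosed.isOpen_compl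
    obtain ⟨ε, hε, hb⟩ := Metric.isOpen_iff.1 hop 1 hM1
    refine ⟨max (1 - ε) (1/2), max_lt (by linarith) (by norm_num), by positivity, ?_⟩
    intro s hs a ha hm
    have hs1 := (le_max_left _ _).trans_lt hs.1
    have hs2 := (le_max_right _ _).trans_lt hs.1
    have hsb : s ∈ ball (1:ℝ) ε := by
      rw [mem_ball, Real.dist_eq, abs_lt]
      constructor <;> linarith [hs.2]
    exact hb hsb ⟨(s, a), ⟨⟨⟨by linarith, hs.2.le⟩, ⟨ha.1.le, ha.2.le⟩⟩, hm⟩, rfl⟩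
  set T : Set ℂ := P '' (Ioo ρ 1 ×ˢ Ioo (-κ) κ) with hT
  have hTpc : IsPreconnected T :=
    (((convex_Ioo ρ 1).prod (convex_Ioo (-κ) κ)).isPreconnected).image _ hPc.continuousOn
  have hTB : T ⊆ ball 0 1 := by
    rintro _ ⟨⟨s, a⟩, ⟨hs, ha⟩, rfl⟩
    rw [mem_ball_zero_iff, hPn _ (hρ0.trans hs.1).le]
    exact hs.2
  have hTJ : ∀ u ∈ T, l (W u) ≠ 0 := by
    intro u hu h0
    have huB := hTB hu
    have : u ∈ J := ⟨W u, ⟨ball_subset_closedBall (h.Wm huB), h0⟩, by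
      rw [hV _ (h.Wm huB), h.VW u huB]⟩
    obtain ⟨⟨s, a⟩, ⟨hs, ha⟩, rfl⟩ := hu
    exact hρ s hs a ha this
  have hmem : ∀ u : ℂ, ρ < ‖u‖ → ‖u‖ < 1 → |(-u/p).arg| < κ → u ∈ T := by
    intro u hu hu1 hk
    refine ⟨(‖u‖, (-u/p).arg), ⟨⟨hu, hu1⟩, abs_lt.1 hk⟩, ?_⟩
    have h3 := Complex.norm_mul_exp_arg_mul_I (-u / p)
    rw [norm_div, norm_neg, hpn, div_one] at h3
    simp only [hP]
    rw [h3]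
    field_simp
  -- radial approach
  have hrad : ∀ ξ : ℂ, ‖ξ‖ = 1 → Vb ξ ≠ p → |(-(Vb ξ)/p).arg| < κ → ∀ O : Set ℂ, IsOpen O →
      ξ ∈ O → ∃ w ∈ ball (0:ℂ) 1, w ∈ O ∧ V w ∈ T := by
    intro ξ hξ hξp hk O hO hξO
    have hcl : ξ ∈ closure (ball (0:ℂ) 1) := by
      rw [closure_ball _ one_ne_zero, mem_closedBall_zero_iff, hξ]
    have hnb : (𝓝[ball 0 1] ξ).NeBot := mem_closure_iff_nhdsWithin_neBot.1 hcl
    have ht : Tendsto Vb (𝓝[ball 0 1] ξ) (𝓝 (Vb ξ)) :=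
      (hc ξ (by rw [mem_closedBall_zero_iff, hξ])).mono_left
        (nhdsWithin_mono _ ball_subset_closedBall)
    have e1 : ∀ᶠ u in 𝓝 (Vb ξ), ρ < ‖u‖ :=
      continuous_norm.continuousAt.eventually (lt_mem_nhds (by simp only [hS ξ hξ]; exact hρ1))
    have e2 : ∀ᶠ u in 𝓝 (Vb ξ), |(-u/p).arg| < κ := by
      have hca : ContinuousAt (fun u : ℂ => |(-u/p).arg|) (Vb ξ) := by
        refine ContinuousAt.abs ?_
        refine ContinuousAt.comp (f := fun u : ℂ => -u / p) (g := Complex.arg) ?_ (by fun_prop)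
        exact Complex.continuousAt_arg (harg _ (hS ξ hξ) hξp)
      exact hca.eventually (gt_mem_nhds hk)
    have := ((ht.eventually e1).and (ht.eventually e2)).and
      ((eventually_mem_nhdsWithin (a := ξ) (s := ball (0:ℂ) 1)).and
        (mem_nhdsWithin_of_mem_nhds (hO.mem_nhds hξO)))
    obtain ⟨w, ⟨ha, hb⟩, hwB, hwO⟩ := this.exists
    refine ⟨w, hwB, hwO, ?_⟩
    rw [hV w hwB] at ha hb
    have := h.Vm hwB
    rw [mem_ball_zero_iff] at this
    exact hmem _ ha this hb
  obtain ⟨w1, hw1B, hw1O, hw1T⟩ := hrad ξ1 hξ1 hq1 hκ1 {w | 0 < l w}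
    (isOpen_lt continuous_const hlc) hl1
  obtain ⟨w2, hw2B, hw2O, hw2T⟩ := hrad ξ2 hξ2 hq2 hκ2 {w | l w < 0}
    (isOpen_lt hlc continuous_const) hl2
  have hpc : IsPreconnected ((fun u => l (W u)) '' T) :=
    hTpc.image _ (hlc.comp_continuousOn (h.Wc.mono hTB))
  have m1 : l w1 ∈ (fun u => l (W u)) '' T := ⟨V w1, hw1T, by simp only [h.WV w1 hw1B]⟩
  have m2 : l w2 ∈ (fun u => l (W u)) '' T := ⟨V w2, hw2T, by simp only [h.WV w2 hw2B]⟩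
  obtain ⟨u, hu, hu0⟩ := hpc.Icc_subset m2 m1 ⟨le_of_lt hw2O, le_of_lt hw1O⟩
  exact hTJ u hu hu0

lemma DiscHomeo.injOn {V W Vb H : ℂ → ℂ} (h : DiscHomeo V W)
    (hc : ContinuousOn Vb (closedBall 0 1)) (hV : ∀ w ∈ ball (0:ℂ) 1, Vb w = V w)
    (hS : ∀ w, ‖w‖ = 1 → ‖Vb w‖ = 1) (hH : Continuous H) (hHi : Function.Injective H)
    (hd : DifferentiableOn ℂ (fun w => H (V w)) (ball 0 1)) : InjOn Vb (closedBall 0 1) := by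
  have hcl : closure (ball (0:ℂ) 1) = closedBall 0 1 := closure_ball _ one_ne_zero
  -- constancy on an arc is impossible
  have hno : ∀ p : ℂ, ‖p‖ = 1 → ∀ O : Set ℂ, IsOpen O → ∀ ξ ∈ O, ‖ξ‖ = 1 →
      ¬ (∀ z ∈ O, ‖z‖ = 1 → Vb z = p) := by
    intro p hp O hO ξ hξO hξ hcon
    have hf : DiffContOnCl ℂ (fun w => H (Vb w) - H p) (ball 0 1) := by
      constructor
      · refine DifferentiableOn.sub_const ?_ _
        exact hd.congr fun w hw => by rw [hV w hw]
      · rw [hcl]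
        exact (hH.comp_continuousOn hc).sub continuousOn_const
    have := const_arc hf hO hξ hξO (fun z hz hz1 => by rw [hcon z hz hz1, sub_self])
    have h3 : Vb 0 = p := hHi (sub_eq_zero.1 this)
    rw [hV 0 zero_mem_B, h.V0] at h3
    rw [← h3] at hp
    simp at hp
  intro ζ1 hz1 ζ2 hz2 heq
  rw [mem_closedBall_zero_iff] at hz1 hz2
  rcases hz1.lt_or_eq with h1 | h1 <;> rcases hz2.lt_or_eq with h2 | h2
  · have m1 : ζ1 ∈ ball (0:ℂ) 1 := by rwa [mem_ball_zero_iff]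
    have m2 : ζ2 ∈ ball (0:ℂ) 1 := by rwa [mem_ball_zero_iff]
    rw [hV _ m1, hV _ m2] at heq
    rw [← h.WV _ m1, ← h.WV _ m2, heq]
  · exfalso
    have m1 : ζ1 ∈ ball (0:ℂ) 1 := by rwa [mem_ball_zero_iff]
    have h3 := h.Vm m1
    rw [← hV _ m1, heq, mem_ball_zero_iff, hS _ h2] at h3
    exact lt_irrefl _ h3
  · exfalso
    have m1 : ζ2 ∈ ball (0:ℂ) 1 := by rwa [mem_ball_zero_iff]
    have h3 := h.Vm m1
    rw [← hV _ m1, ← heq, mem_ball_zero_iff, hS _ h1] at h3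
    exact lt_irrefl _ h3
  · by_contra hne
    set n := Complex.I * (ζ2 - ζ1) with hn
    have hn0 : n ≠ 0 := mul_ne_zero Complex.I_ne_zero (sub_ne_zero.2 (Ne.symm hne))
    have ho : inner ℝ n (ζ2 - ζ1) = 0 := by
      rw [hn]; simp [Complex.inner]; ring
    obtain ⟨ξ1, hξ1, hl1⟩ := exists_unit_pos hn0 h1 h2 hne ho
    obtain ⟨ξ2, hξ2, hl2⟩ := exists_unit_pos (neg_ne_zero.2 hn0) h1 h2 hne
      (by rw [inner_neg_left, ho, neg_zero])
    rw [inner_neg_left, neg_pos] at hl2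
    have hlc : Continuous (fun w : ℂ => (inner ℝ n (w - ζ1) : ℝ)) := by fun_prop
    have a1 := hno (Vb ζ1) (hS _ h1) {w | 0 < inner ℝ n (w - ζ1)}
      (isOpen_lt continuous_const hlc) ξ1 hl1 hξ1
    have a2 := hno (Vb ζ1) (hS _ h1) {w | inner ℝ n (w - ζ1) < 0}
      (isOpen_lt hlc continuous_const) ξ2 hl2 hξ2
    push Not at a1 a2
    obtain ⟨η1, b1, c1, d1⟩ := a1
    obtain ⟨η2, b2, c2, d2⟩ := a2
    exact h.sides hc hV hS h1 h2 hne rfl heq.symm c1 c2 b1 b2 d1 d2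

/-- Caratheodory extension for a flatly embedded closed disc. -/
theorem caratheodory (H : ℂ ≃ₜ ℂ) (h0 : H 0 = 0) : ∃ Vb ψ : ℂ → ℂ,
    ContinuousOn Vb (closedBall 0 1) ∧ BijOn Vb (closedBall 0 1) (closedBall 0 1) ∧
    (∀ w, ‖w‖ = 1 → ‖Vb w‖ = 1) ∧ (∀ w ∈ ball (0:ℂ) 1, Vb w ∈ ball (0:ℂ) 1) ∧
    (∀ w ∈ ball (0:ℂ) 1, H (Vb w) = ψ w) ∧
    DifferentiableOn ℂ ψ (ball 0 1) ∧ ψ 0 = 0 ∧ deriv ψ 0 ≠ 0 := by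
  have hUo : IsOpen (H '' ball 0 1) := H.isOpenMap _ isOpen_ball
  have hUs : IsSimplyConnected (H '' ball (0:ℂ) 1) := by
    rw [Homeomorph.isSimplyConnected_image]
    have : ContractibleSpace (ball (0:ℂ) 1) :=
      (convex_ball (0:ℂ) 1).contractibleSpace ⟨0, zero_mem_B⟩
    exact SimplyConnectedSpace.ofContractible _
  have hUb : Bornology.IsBounded (H '' ball (0:ℂ) 1) :=
    ((isCompact_closedBall (0:ℂ) 1).image H.continuous).isBounded.subset
      (image_mono ball_subset_closedBall)
  obtain ⟨φ, ψ, hφc, hφm, hψd, hψm, h1, h2, h3, h4⟩ := rmt_inv hUo hUs ⟨0, zero_mem_B, h0⟩ hUb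
  have hD : DiscHomeo (fun w => H.symm (ψ w)) (fun u => φ (H u)) := by
    refine ⟨?_, ?_, ?_, ?_, ?_, ?_, ?_⟩
    · intro w hw
      obtain ⟨u, hu, hu2⟩ := hψm hw
      simp only [← hu2, H.symm_apply_apply]
      exact hu
    · intro u hu
      exact hφm (mem_image_of_mem _ hu)
    · exact H.symm.continuous.comp_continuousOn hψd.continuousOn
    · exact hφc.comp H.continuous.continuousOn (mapsTo_image _ _)
    · intro w hw
      simp only [H.apply_symm_apply]
      exact h2 w hw
    · intro u hu
      rw [h1 _ (mem_image_of_mem _ hu), H.symm_apply_apply]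
    · rw [h3, H.symm_apply_eq, h0]
  have hψi : InjOn ψ (ball 0 1) := fun a ha b hb hab => by rw [← h2 a ha, ← h2 b hb, hab]
  have hX : Cross (fun w => H.symm (ψ w)) := by
    intro ζ hζ ε hε ρ hρ
    have huc : UniformContinuousOn H.symm (H '' closedBall 0 1) :=
      ((isCompact_closedBall (0:ℂ) 1).image H.continuous).uniformContinuousOn_of_continuous
        H.symm.continuous.continuousOn
    obtain ⟨δ, hδ, hu⟩ := Metric.uniformContinuousOn_iff_le.1 huc ε hε
    obtain ⟨r, hr, hr2⟩ := length_area hψd hψi (hUb.subset hψm.image_subset) hζ hδ hρ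
    refine ⟨r, hr, fun w hw w' hw' hd hd' => ?_⟩
    exact hu _ (image_mono ball_subset_closedBall (hψm hw)) _
      (image_mono ball_subset_closedBall (hψm hw')) (hr2 w hw w' hw' hd hd')
  obtain ⟨Vb, hc, hV, hS, hsurj⟩ := hD.extend hX
  have hHV : ∀ w ∈ ball (0:ℂ) 1, H (Vb w) = ψ w := by
    intro w hw
    rw [hV w hw, H.apply_symm_apply]
  refine ⟨Vb, ψ, hc, ⟨?_, ?_, hsurj⟩, hS,
    fun w hw => by rw [hV w hw]; exact hD.Vm hw, hHV, hψd, h3, h4⟩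
  · intro w hw
    rw [mem_closedBall_zero_iff] at hw ⊢
    rcases hw.lt_or_eq with h5 | h5
    · have m1 : w ∈ ball (0:ℂ) 1 := by rwa [mem_ball_zero_iff]
      have := hD.Vm m1
      rw [← hV w m1, mem_ball_zero_iff] at this
      exact this.le
    · exact (hS w h5).le
  · exact hD.injOn hc hV hS H.continuous H.injective (by simpa using hψd)

end AnnExt

namespace AnnExt
open Metric

/-- A unit complex number as a point of the circle. -/
def mkC (u : ℂ) (h : ‖u‖ = 1) : Circle := ⟨u, mem_sphere_zero_iff_norm.2 h⟩

lemma mkC_coe (u : ℂ) (h : ‖u‖ = 1) : (mkC u h : ℂ) = u := rfl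

lemma ind_circle : IsInducing (fun z : Circle => (z : ℂ)) := ⟨rfl⟩

lemma cont_coe : Continuous (fun z : Circle => (z : ℂ)) := ind_circle.continuous

/-- The direction of a complex number (junk value one at zero). -/
def dir (u : ℂ) : Circle :=
  if h : u = 0 then 1 else mkC (u / ‖u‖) (by simp [h])

lemma dir_coe {u : ℂ} (h : u ≠ 0) : (dir u : ℂ) = u / ‖u‖ := by
  rw [dir, dif_neg h, mkC_coe]

lemma norm_mul_dir (u : ℂ) : (‖u‖ : ℂ) * dir u = u := by
  by_cases h : u = 0
  · simp [h]
  · have : (‖u‖ : ℂ) ≠ 0 := by simpa using h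
    rw [dir_coe h]; field_simp

lemma dir_eq {u : ℂ} {z : Circle} {r : ℝ} (hr : 0 < r) (h : u = r * z) : dir u = z := by
  have hn : ‖u‖ = r := by rw [h]; simp [abs_of_pos hr, Circle.norm_coe]
  have h0 : u ≠ 0 := by rw [← norm_pos_iff, hn]; exact hr
  have hr' : (r : ℂ) ≠ 0 := by exact_mod_cast hr.ne'
  ext
  rw [dir_coe h0, hn, h]; field_simp

lemma dir_coe_circle (z : Circle) : dir (z : ℂ) = z := dir_eq one_pos (by simp)

lemma dir_mul {u v : ℂ} (hu : u ≠ 0) (hv : v ≠ 0) : dir (u * v) = dir u * dir v := by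
  refine dir_eq (r := ‖u‖ * ‖v‖) (by positivity) ?_
  have h1 := norm_mul_dir u
  have h2 := norm_mul_dir v
  push_cast
  linear_combination (-(v : ℂ)) * h1 - (‖u‖ : ℂ) * dir u * h2

lemma continuousAt_dir {u : ℂ} (h : u ≠ 0) : ContinuousAt dir u := by
  rw [ind_circle.continuousAt_iff]
  have h1 : ContinuousAt (fun u : ℂ => u / (‖u‖ : ℂ)) u := by
    refine ContinuousAt.div continuousAt_id (by fun_prop) (by simpa using h)
  refine h1.congr ?_
  filter_upwards [isOpen_ne.mem_nhds h] with v hv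
  exact (dir_coe hv).symm

/-- Conical extension of a self-map of the circle. -/
def cone (f : Circle → Circle) (u : ℂ) : ℂ := ‖u‖ * f (dir u)

lemma norm_cone (f : Circle → Circle) (u : ℂ) : ‖cone f u‖ = ‖u‖ := by simp [cone, Circle.norm_coe]

lemma cone_zero (f : Circle → Circle) : cone f 0 = 0 := by simp [cone]

lemma dir_cone (f : Circle → Circle) {u : ℂ} (h : u ≠ 0) : dir (cone f u) = f (dir u) :=
  dir_eq (norm_pos_iff.2 h) rfl

lemma cone_circle (f : Circle → Circle) (z : Circle) : cone f z = f z := by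
  simp [cone, dir_coe_circle, Circle.norm_coe]

lemma cone_cone {f g : Circle → Circle} (h : ∀ z, f (g z) = z) (u : ℂ) : cone f (cone g u) = u := by
  by_cases hu : u = 0
  · simp [hu, cone_zero]
  · rw [cone, norm_cone, dir_cone g hu, h, norm_mul_dir]

lemma continuous_cone {f : Circle → Circle} (hf : Continuous f) : Continuous (cone f) := by
  rw [continuous_iff_continuousAt]
  intro u
  by_cases hu : u = 0
  · subst hu
    rw [ContinuousAt, cone_zero, tendsto_zero_iff_norm_tendsto_zero]
    simp only [norm_cone]
    exact tendsto_norm_zero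
  · unfold cone
    refine ContinuousAt.mul (by fun_prop) ?_
    exact (cont_coe.comp hf).continuousAt.comp (continuousAt_dir hu)

/-- Glueing with the identity outside of the closed disc. -/
lemma glue_id {f : ℂ → ℂ} (hc : ContinuousOn f (closedBall 0 1))
    (hb : BijOn f (closedBall 0 1) (closedBall 0 1)) (hs : ∀ u, ‖u‖ = 1 → f u = u) :
    ∃ k : ℂ ≃ₜ ℂ, (∀ u, ‖u‖ ≤ 1 → k u = f u) ∧ (∀ u, 1 ≤ ‖u‖ → k u = u) := by
  classical
  have key : ∀ f : ℂ → ℂ, ContinuousOn f (closedBall 0 1) → (∀ u, ‖u‖ = 1 → f u = u) →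
      Continuous (fun u => if ‖u‖ ≤ 1 then f u else u) := by
    intro f hc hs
    refine continuous_if_le continuous_norm continuous_const ?_ continuousOn_id ?_
    · refine hc.mono fun u hu => ?_
      rw [mem_closedBall_zero_iff]; exact hu
    · intro u hu; exact hs u hu
  set g := Function.invFunOn f (closedBall 0 1) with hg
  have hgm : ∀ u, ‖u‖ ≤ 1 → ‖g u‖ ≤ 1 ∧ f (g u) = u := by
    intro u hu
    have hu' : u ∈ f '' closedBall 0 1 := hb.surjOn (by rwa [mem_closedBall_zero_iff])
    exact ⟨by simpa using Function.invFunOn_mem hu', Function.invFunOn_eq hu'⟩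
  have hfm : ∀ u, ‖u‖ ≤ 1 → ‖f u‖ ≤ 1 := by
    intro u hu
    have := hb.mapsTo (mem_closedBall_zero_iff.2 hu)
    rwa [mem_closedBall_zero_iff] at this
  have hgf : ∀ u, ‖u‖ ≤ 1 → g (f u) = u := by
    intro u hu
    refine hb.injOn ?_ (mem_closedBall_zero_iff.2 hu) (hgm _ (hfm u hu)).2
    exact mem_closedBall_zero_iff.2 (hgm _ (hfm u hu)).1
  have hgs : ∀ u, ‖u‖ = 1 → g u = u := by
    intro u hu
    have := hgf u hu.le
    rwa [hs u hu] at this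
  have hgc : ContinuousOn g (closedBall 0 1) := by
    rw [continuousOn_iff_isClosed]
    intro t ht
    refine ⟨f '' (t ∩ closedBall 0 1), ?_, ?_⟩
    · refine IsCompact.isClosed ?_
      exact ((isCompact_closedBall _ _).inter_left ht).image_of_continuousOn
        (hc.mono inter_subset_right)
    · ext u
      simp only [mem_inter_iff, mem_preimage, mem_closedBall_zero_iff, mem_image]
      constructor
      · rintro ⟨h1, h2⟩
        exact ⟨⟨g u, ⟨h1, (hgm u h2).1⟩, (hgm u h2).2⟩, h2⟩
      · rintro ⟨⟨v, ⟨h1, h2⟩, rfl⟩, h3⟩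
        rw [hgf v h2]
        exact ⟨h1, h3⟩
  refine ⟨⟨⟨fun u => if ‖u‖ ≤ 1 then f u else u, fun u => if ‖u‖ ≤ 1 then g u else u,
    ?_, ?_⟩, key f hc hs, key g hgc hgs⟩, ?_, ?_⟩
  · intro u
    by_cases h : ‖u‖ ≤ 1
    · simp only [h, if_true, hfm u h, hgf u h]
    · simp only [h, if_false]
  · intro u
    by_cases h : ‖u‖ ≤ 1
    · simp only [h, if_true, (hgm u h).1, (hgm u h).2]
    · simp only [h, if_false]
  · intro u hu
    exact if_pos hu
  · intro u hu
    change (if ‖u‖ ≤ 1 then f u else u) = u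
    split_ifs with h
    · exact hs u (le_antisymm h hu)
    · rfl

/-- The planar lemma: after a modification supported in the unit disc, a homeomorphism of the
plane fixing zero becomes one which extends to the blow-up at zero. -/
theorem planar (H : ℂ ≃ₜ ℂ) (h0 : H 0 = 0) : ∃ k : ℂ ≃ₜ ℂ, k 0 = 0 ∧ (∀ u, 1 ≤ ‖u‖ → k u = u) ∧
    ∃ b : Circle → Circle, Function.Bijective b ∧ ∀ z,
      Tendsto (fun u => dir (H (k u))) (𝓝[≠] 0 ⊓ comap dir (𝓝 z)) (𝓝 (b z)) := by
  obtain ⟨Vb, ψ, hc, hb, hS, hVB, hV, hd, hψ0, hψ1⟩ := caratheodory H h0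
  have hV0 : Vb 0 = 0 := by
    apply H.injective
    rw [hV 0 zero_mem_B, hψ0, h0]
  -- the boundary map
  have hzB : ∀ z : Circle, (z : ℂ) ∈ closedBall (0:ℂ) 1 := fun z => by
    rw [mem_closedBall_zero_iff, Circle.norm_coe]
  set γ : Circle → Circle := fun z => mkC (Vb z) (hS z (Circle.norm_coe z)) with hγ
  have hγc : Continuous γ := by
    rw [ind_circle.continuous_iff]
    exact hc.comp_continuous cont_coe hzB
  have hγi : Function.Injective γ := by
    intro z z' h
    have h1 : Vb z = Vb z' := congrArg Subtype.val h
    exact Circle.ext (hb.injOn (hzB z) (hzB z') h1)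
  have hγs : Function.Surjective γ := by
    intro z
    obtain ⟨w, hw, hwz⟩ := hb.surjOn (hzB z)
    rw [mem_closedBall_zero_iff] at hw
    have hw1 : ‖w‖ = 1 := by
      by_contra hcon
      have hwB : w ∈ ball (0:ℂ) 1 := by
        rw [mem_ball_zero_iff]; exact lt_of_le_of_ne hw hcon
      have := hVB w hwB
      rw [hwz, mem_ball_zero_iff, Circle.norm_coe] at this
      exact lt_irrefl _ this
    refine ⟨mkC w hw1, ?_⟩
    ext
    exact hwz
  set Γ : Circle ≃ₜ Circle := Continuous.homeoOfEquivCompactToT2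
    (f := Equiv.ofBijective γ ⟨hγi, hγs⟩) hγc with hΓ
  have hΓγ : ∀ z, Γ z = γ z := fun z => rfl
  have hcone : ∀ u : ℂ, ‖u‖ ≤ 1 → cone Γ.symm u ∈ closedBall (0:ℂ) 1 := by
    intro u hu
    rwa [mem_closedBall_zero_iff, norm_cone]
  have hbij : BijOn (fun u => Vb (cone Γ.symm u)) (closedBall 0 1) (closedBall 0 1) := by
    have hcb : BijOn (cone Γ.symm) (closedBall 0 1) (closedBall 0 1) := by
      refine ⟨fun u hu => hcone u (mem_closedBall_zero_iff.1 hu), ?_, ?_⟩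
      · intro u _ v _ huv
        rw [← cone_cone (f := Γ) (g := Γ.symm) (by simp) u, huv,
          cone_cone (f := Γ) (g := Γ.symm) (by simp) v]
      · intro u hu
        refine ⟨cone Γ u, ?_, cone_cone (by simp) u⟩
        rwa [mem_closedBall_zero_iff, norm_cone, ← mem_closedBall_zero_iff]
    exact hb.comp hcb
  have hsph : ∀ u : ℂ, ‖u‖ = 1 → Vb (cone Γ.symm u) = u := by
    intro u hu
    obtain ⟨z, rfl⟩ : ∃ z : Circle, (z : ℂ) = u :=
      ⟨mkC u hu, rfl⟩
    simp only [cone_circle]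
    have h1 : γ (Γ.symm z) = z := Γ.apply_symm_apply z
    exact congrArg Subtype.val h1
  obtain ⟨k, hk1, hk2⟩ := glue_id (f := fun u => Vb (cone Γ.symm u))
    (hc.comp (continuous_cone Γ.symm.continuous).continuousOn
      (fun u hu => hcone u (mem_closedBall_zero_iff.1 hu))) hbij hsph
  · refine ⟨k, ?_, hk2, ?_⟩
    · rw [hk1 0 (by simp), cone_zero, hV0]
    set f : ℂ → ℂ := fun w => H (Vb w) with hf
    have hfψ : ∀ w ∈ ball (0:ℂ) 1, f w = ψ w := hV
    set χ := dslope f 0 with hχ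
    have hfe : f =ᶠ[𝓝 0] ψ := by
      filter_upwards [isOpen_ball.mem_nhds zero_mem_B] with w hw using hfψ w hw
    have hfd : DifferentiableAt ℂ f 0 :=
      (hd.differentiableAt (isOpen_ball.mem_nhds zero_mem_B)).congr_of_eventuallyEq hfe
    have hχc : ContinuousAt χ 0 := continuousAt_dslope_same.2 hfd
    have hχ0 : χ 0 ≠ 0 := by
      rw [hχ, dslope_same, hfe.deriv_eq]; exact hψ1
    have hf0 : f 0 = 0 := by simp only [hf, hV0, h0]
    have hfχ : ∀ w, f w = w * χ w := by
      intro w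
      have := sub_smul_dslope f 0 w
      rw [hf0, sub_zero, sub_zero, smul_eq_mul] at this
      exact this.symm
    refine ⟨fun z => Γ.symm z * dir (χ 0),
      (Equiv.mulRight (dir (χ 0))).bijective.comp Γ.symm.bijective, fun z => ?_⟩
    have hl : Tendsto (fun u => Γ.symm (dir u) * dir (χ (cone Γ.symm u)))
        (𝓝[≠] 0 ⊓ comap dir (𝓝 z)) (𝓝 (Γ.symm z * dir (χ 0))) := by
      refine Tendsto.mul ?_ ?_
      · exact (Γ.symm.continuous.tendsto z).comp (tendsto_comap.mono_left inf_le_right)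
      · have h1 : ContinuousAt (fun u => dir (χ (cone Γ.symm u))) 0 := by
          have h2 : ContinuousAt (fun u => χ (cone Γ.symm u)) 0 := by
            refine ContinuousAt.comp (f := cone Γ.symm) (g := χ) ?_
              (continuous_cone Γ.symm.continuous).continuousAt
            rw [cone_zero]; exact hχc
          refine ContinuousAt.comp (f := fun u => χ (cone Γ.symm u)) (g := dir) ?_ h2
          rw [cone_zero]
          exact continuousAt_dir hχ0
        have h3 := h1.tendsto
        simp only [cone_zero] at h3
        exact h3.mono_left (inf_le_left.trans nhdsWithin_le_nhds)
    refine hl.congr' ?_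
    have hev : ∀ᶠ u in 𝓝 (0:ℂ), ‖u‖ ≤ 1 ∧ χ (cone Γ.symm u) ≠ 0 := by
      refine Filter.Eventually.and ?_ ?_
      · filter_upwards [closedBall_mem_nhds (0:ℂ) one_pos] with u hu
        simpa using hu
      · have h2 : ContinuousAt (fun u => χ (cone Γ.symm u)) 0 := by
          refine ContinuousAt.comp (f := cone Γ.symm) (g := χ) ?_
            (continuous_cone Γ.symm.continuous).continuousAt
          rw [cone_zero]; exact hχc
        exact h2.eventually_ne (by simpa only [cone_zero] using hχ0)
    have hev2 : ∀ᶠ u in 𝓝[≠] (0:ℂ) ⊓ comap dir (𝓝 z), u ≠ 0 :=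
      (eventually_mem_nhdsWithin).filter_mono inf_le_left
    filter_upwards [hev.filter_mono (inf_le_left.trans nhdsWithin_le_nhds), hev2] with u hu hu0
    have hcu : cone Γ.symm u ≠ 0 := by
      rw [← norm_pos_iff, norm_cone, norm_pos_iff]; exact hu0
    rw [hk1 u hu.1]
    change _ = dir (f (cone Γ.symm u))
    rw [hfχ, dir_mul hcu hu.2, dir_cone _ hu0]

end AnnExt

namespace AnnExt
open Metric

lemma planar_scaled (H : ℂ ≃ₜ ℂ) (h0 : H 0 = 0) {R : ℝ} (hR : 0 < R) :
    ∃ k : ℂ ≃ₜ ℂ, k 0 = 0 ∧ (∀ u, R ≤ ‖u‖ → k u = u) ∧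
    ∃ b : Circle → Circle, Function.Bijective b ∧ ∀ z,
      Tendsto (fun u => dir (H (k u))) (𝓝[≠] 0 ⊓ comap dir (𝓝 z)) (𝓝 (b z)) := by
  have hRC : (R : ℂ) ≠ 0 := by exact_mod_cast hR.ne'
  set S : ℂ ≃ₜ ℂ := Homeomorph.mulLeft₀ (R : ℂ) hRC with hS
  have hSa : ∀ u, S u = R * u := fun u => rfl
  have hSs : ∀ u, S.symm u = (R : ℂ)⁻¹ * u := fun u => rfl
  obtain ⟨k, hk0, hk1, b, hb, hk2⟩ := planar (S.trans H) (by
    rw [Homeomorph.trans_apply, hSa, mul_zero, h0])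
  refine ⟨(S.symm.trans k).trans S, ?_, ?_, b, hb, fun z => ?_⟩
  · simp only [Homeomorph.trans_apply, hSa, hSs, mul_zero, hk0]
  · intro u hu
    simp only [Homeomorph.trans_apply]
    rw [hk1, S.apply_symm_apply]
    rw [hSs, norm_mul, norm_inv, Complex.norm_real, Real.norm_eq_abs, abs_of_pos hR]
    rw [inv_mul_eq_div, le_div_iff₀ hR, one_mul]; exact hu
  · have ht : Tendsto S.symm (𝓝[≠] 0 ⊓ comap dir (𝓝 z)) (𝓝[≠] 0 ⊓ comap dir (𝓝 z)) := by
      have hne : ∀ᶠ u in 𝓝[≠] (0:ℂ) ⊓ comap dir (𝓝 z), u ≠ 0 :=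
        (eventually_mem_nhdsWithin).filter_mono inf_le_left
      refine tendsto_inf.2 ⟨?_, ?_⟩
      · refine tendsto_nhdsWithin_iff.2 ⟨?_, ?_⟩
        · have : Tendsto S.symm (𝓝 0) (𝓝 0) := by
            have := S.symm.continuous.tendsto 0
            rwa [hSs, mul_zero] at this
          exact this.mono_left (inf_le_left.trans nhdsWithin_le_nhds)
        · filter_upwards [hne] with u hu
          rw [hSs]
          exact mul_ne_zero (inv_ne_zero hRC) hu
      · rw [tendsto_comap_iff]
        refine (tendsto_comap.mono_left inf_le_right :
          Tendsto dir (𝓝[≠] 0 ⊓ comap dir (𝓝 z)) (𝓝 z)).congr' ?_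
        filter_upwards [hne] with u hu
        simp only [Function.comp_apply]
        rw [hSs]
        symm
        refine dir_eq (r := R⁻¹ * ‖u‖) (by positivity) ?_
        have := norm_mul_dir u
        push_cast
        linear_combination (-(R : ℂ)⁻¹) * this
    exact (hk2 z).comp ht

/-- Level associated with a radius. -/
def lvl (r : ℝ) : Ioo (0:ℝ) 1 :=
  if h : 0 < r then ⟨1 / (1 + r), by positivity, by rw [div_lt_one (by positivity)]; linarith⟩
  else ⟨1 / 2, by norm_num, by norm_num⟩

lemma lvl_coe {r : ℝ} (h : 0 < r) : (lvl r : ℝ) = 1 / (1 + r) := by rw [lvl, dif_pos h]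

/-- From the annulus to the punctured plane. -/
def toP (x : Ann) : ℂ := ((1 - (x.2 : ℝ)) / (x.2 : ℝ) : ℝ) * (x.1 : ℂ)

/-- From the punctured plane to the annulus. -/
def frP (u : ℂ) : Ann := (dir u, lvl ‖u‖)

lemma rad_pos (x : Ann) : 0 < (1 - (x.2 : ℝ)) / (x.2 : ℝ) :=
  div_pos (by linarith [x.2.2.2]) x.2.2.1

lemma norm_toP (x : Ann) : ‖toP x‖ = (1 - (x.2 : ℝ)) / (x.2 : ℝ) := by
  rw [toP, norm_mul, Circle.norm_coe, Complex.norm_real, Real.norm_eq_abs,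
    abs_of_pos (rad_pos x), mul_one]

lemma toP_ne (x : Ann) : toP x ≠ 0 := by
  rw [← norm_pos_iff, norm_toP]; exact rad_pos x

lemma dir_toP (x : Ann) : dir (toP x) = x.1 := dir_eq (rad_pos x) rfl

lemma frP_toP (x : Ann) : frP (toP x) = x := by
  refine Prod.ext (dir_toP x) (Subtype.ext ?_)
  have h1 : (x.2 : ℝ) ≠ 0 := x.2.2.1.ne'
  change (lvl ‖toP x‖ : ℝ) = x.2
  rw [norm_toP, lvl_coe (rad_pos x)]
  field_simp
  ring

lemma toP_frP {u : ℂ} (hu : u ≠ 0) : toP (frP u) = u := by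
  have h0 : 0 < ‖u‖ := norm_pos_iff.2 hu
  have h1 : ((1 - (lvl ‖u‖ : ℝ)) / (lvl ‖u‖ : ℝ) : ℝ) = ‖u‖ := by
    rw [lvl_coe h0]
    field_simp
    ring
  change (((1 - (lvl ‖u‖ : ℝ)) / (lvl ‖u‖ : ℝ) : ℝ) : ℂ) * (dir u : ℂ) = u
  rw [h1, norm_mul_dir]

lemma continuous_toP : Continuous toP := by
  unfold toP
  refine Continuous.mul ?_ (cont_coe.comp continuous_fst)
  refine Complex.continuous_ofReal.comp ?_
  refine Continuous.div (by fun_prop) (by fun_prop) (fun x => x.2.2.1.ne')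

lemma continuousAt_frP {u : ℂ} (hu : u ≠ 0) : ContinuousAt frP u := by
  refine ContinuousAt.prodMk (continuousAt_dir hu) ?_
  rw [IsInducing.subtypeVal.continuousAt_iff]
  have h0 : 0 < ‖u‖ := norm_pos_iff.2 hu
  have h1 : ContinuousAt (fun v : ℂ => 1 / (1 + ‖v‖)) u :=
    ContinuousAt.div continuousAt_const (by fun_prop) (by positivity)
  refine h1.congr ?_
  filter_upwards [isOpen_ne.mem_nhds hu] with v hv
  exact (lvl_coe (norm_pos_iff.2 hv)).symm

/-- The top end of the annulus. -/
def topF : Filter Ann := comap (fun x : Ann => (x.2 : ℝ)) (𝓝 1)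

lemma tendsto_toP : Tendsto toP topF (𝓝[≠] 0) := by
  refine tendsto_nhdsWithin_iff.2 ⟨?_, Eventually.of_forall toP_ne⟩
  rw [tendsto_zero_iff_norm_tendsto_zero]
  simp only [norm_toP]
  have h1 : Tendsto (fun t : ℝ => (1 - t) / t) (𝓝 1) (𝓝 0) := by
    have : ContinuousAt (fun t : ℝ => (1 - t) / t) 1 :=
      ContinuousAt.div (by fun_prop) continuousAt_id one_ne_zero
    simpa [ContinuousAt] using this
  exact h1.comp tendsto_comap

lemma tendsto_frP : Tendsto frP (𝓝[≠] 0) topF := by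
  rw [topF, tendsto_comap_iff]
  have h1 : Tendsto (fun v : ℂ => 1 / (1 + ‖v‖)) (𝓝[≠] 0) (𝓝 1) := by
    have : ContinuousAt (fun v : ℂ => 1 / (1 + ‖v‖)) 0 :=
      ContinuousAt.div continuousAt_const (by fun_prop) (by simp)
    have h2 := this.tendsto
    simp only [norm_zero, add_zero, div_one] at h2
    exact h2.mono_left nhdsWithin_le_nhds
  refine h1.congr' ?_
  filter_upwards [eventually_mem_nhdsWithin] with v hv
  exact (lvl_coe (norm_pos_iff.2 hv)).symm

open Classical in
/-- The planar map of a map of the annulus. -/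
def plane (h : Ann → Ann) (u : ℂ) : ℂ := if u = 0 then 0 else toP (h (frP u))

lemma plane_zero (h : Ann → Ann) : plane h 0 = 0 := if_pos rfl

lemma plane_ne (h : Ann → Ann) {u : ℂ} (hu : u ≠ 0) : plane h u = toP (h (frP u)) := if_neg hu

lemma plane_plane {f g : Ann → Ann} (h : ∀ x, f (g x) = x) (u : ℂ) : plane f (plane g u) = u := by
  by_cases hu : u = 0
  · rw [hu, plane_zero, plane_zero]
  · rw [plane_ne g hu, plane_ne f (toP_ne _), frP_toP, h, toP_frP hu]

lemma continuous_plane {h : Ann → Ann} (hc : Continuous h) (ht : Tendsto h topF topF) :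
    Continuous (plane h) := by
  rw [continuous_iff_continuousAt]
  intro u
  by_cases hu : u = 0
  · subst hu
    rw [continuousAt_iff_punctured_nhds, plane_zero]
    refine ((tendsto_toP.comp (ht.comp tendsto_frP)).mono_right nhdsWithin_le_nhds).congr' ?_
    filter_upwards [eventually_mem_nhdsWithin] with v hv
    exact (plane_ne h hv).symm
  · have : ContinuousAt (fun u => toP (h (frP u))) u :=
      (continuous_toP.comp hc).continuousAt.comp (continuousAt_frP hu)
    refine this.congr ?_
    filter_upwards [isOpen_ne.mem_nhds hu] with v hv
    exact (plane_ne h hv).symm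

/-- The planar homeomorphism of a homeomorphism of the annulus preserving the top end. -/
def planeH (h : Ann ≃ₜ Ann) (h1 : Tendsto h topF topF) (h2 : Tendsto h.symm topF topF) :
    ℂ ≃ₜ ℂ where
  toFun := plane h
  invFun := plane h.symm
  left_inv := plane_plane h.symm_apply_apply
  right_inv := plane_plane h.apply_symm_apply
  continuous_toFun := continuous_plane h.continuous h1
  continuous_invFun := continuous_plane h.symm.continuous h2

lemma annOf_aux {f g : ℂ → ℂ} (h : ∀ x, f (g x) = x) (hf0 : f 0 = 0) (x : Ann) :
    frP (f (toP (frP (g (toP x))))) = x := by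
  have : g (toP x) ≠ 0 := by
    intro h0
    apply toP_ne x
    rw [← h (toP x), h0, hf0]
  rw [toP_frP this, h, frP_toP]

lemma annOf_cont {f g : ℂ → ℂ} (h : ∀ x, f (g x) = x) (hf0 : f 0 = 0) (hg : Continuous g) :
    Continuous (fun x => frP (g (toP x))) := by
  rw [continuous_iff_continuousAt]
  intro x
  have : g (toP x) ≠ 0 := by
    intro h0
    apply toP_ne x
    rw [← h (toP x), h0, hf0]
  exact ContinuousAt.comp (f := fun x => g (toP x)) (g := frP) (continuousAt_frP this)
    (hg.comp continuous_toP).continuousAt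

/-- The homeomorphism of the annulus induced by a planar homeomorphism fixing zero. -/
def annOf (k : ℂ ≃ₜ ℂ) (k0 : k 0 = 0) : Ann ≃ₜ Ann where
  toFun x := frP (k (toP x))
  invFun x := frP (k.symm (toP x))
  left_inv x := annOf_aux k.symm_apply_apply (by rw [k.symm_apply_eq, k0]) x
  right_inv x := annOf_aux k.apply_symm_apply k0 x
  continuous_toFun := annOf_cont k.symm_apply_apply (by rw [k.symm_apply_eq, k0]) k.continuous
  continuous_invFun := annOf_cont k.apply_symm_apply k0 k.symm.continuous

/-- Modification near the top end making a homeomorphism extendable to the top boundary. -/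
theorem top_lemma (h : Ann ≃ₜ Ann) (h1 : Tendsto h topF topF) (h2 : Tendsto h.symm topF topF)
    {s : ℝ} (hs : s ∈ Ioo (0:ℝ) 1) : ∃ k : Ann ≃ₜ Ann, (∀ x, (x.2 : ℝ) ≤ s → k x = x) ∧
    ∃ b : Circle → Circle, Function.Bijective b ∧ ∀ z : Circle,
      Tendsto (fun x => emb (h (k x))) (comap emb (𝓝 (z, 1))) (𝓝 (b z, 1)) := by
  obtain ⟨κ, k0, k1, b, hb, hk⟩ := planar_scaled (planeH h h1 h2) (plane_zero h)
    (R := (1 - s) / s) (div_pos (by linarith [hs.2]) hs.1)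
  refine ⟨annOf κ k0, ?_, b, hb, fun z => ?_⟩
  · intro x hx
    change frP (κ (toP x)) = x
    rw [k1, frP_toP]
    rw [norm_toP, div_le_div_iff₀ hs.1 x.2.2.1]
    nlinarith
  · have hne : ∀ x, κ (toP x) ≠ 0 := by
      intro x h0
      apply toP_ne x
      apply κ.injective
      rw [h0, k0]
    have hHne : ∀ x, planeH h h1 h2 (κ (toP x)) ≠ 0 := by
      intro x h0
      apply hne x
      apply (planeH h h1 h2).injective
      rw [h0]
      exact (plane_zero h).symm
    have heq : ∀ x, h (annOf κ k0 x) = frP (planeH h h1 h2 (κ (toP x))) := by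
      intro x
      change h (frP (κ (toP x))) = frP (plane h (κ (toP x)))
      rw [plane_ne h (hne x), frP_toP]
    have ht2 : Tendsto (fun x : Ann => (x.2 : ℝ)) (comap emb (𝓝 (z, 1))) (𝓝 1) := by
      have hc : Continuous (fun y : ClAnn => (y.2 : ℝ)) := by fun_prop
      exact (hc.tendsto (z, 1)).comp tendsto_comap
    have ht1 : Tendsto (fun x : Ann => x.1) (comap emb (𝓝 (z, 1))) (𝓝 z) :=
      (continuous_fst.tendsto ((z, 1) : ClAnn)).comp tendsto_comap
    have htop : Tendsto toP (comap emb (𝓝 (z, 1))) (𝓝[≠] 0) :=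
      tendsto_toP.comp (tendsto_comap_iff.2 ht2)
    have ht : Tendsto toP (comap emb (𝓝 (z, 1))) (𝓝[≠] 0 ⊓ comap dir (𝓝 z)) := by
      refine tendsto_inf.2 ⟨htop, ?_⟩
      rw [tendsto_comap_iff]
      refine ht1.congr fun x => (dir_toP x).symm
    have hd := (hk z).comp ht
    have hl : Tendsto (fun x => frP (planeH h h1 h2 (κ (toP x)))) (comap emb (𝓝 (z, 1))) topF := by
      refine tendsto_frP.comp (tendsto_nhdsWithin_iff.2 ⟨?_, Eventually.of_forall hHne⟩)
      have hcc : Continuous (fun u => planeH h h1 h2 (κ u)) :=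
        (planeH h h1 h2).continuous.comp κ.continuous
      have := hcc.tendsto 0
      simp only [k0] at this
      rw [show planeH h h1 h2 0 = 0 from plane_zero h] at this
      exact this.comp (htop.mono_right nhdsWithin_le_nhds)
    simp only [heq]
    refine Tendsto.prodMk_nhds hd ?_
    rw [IsInducing.subtypeVal.tendsto_nhds_iff]
    exact (tendsto_comap_iff (f := _) (g := fun x : Ann => (x.2 : ℝ))).1 hl

end AnnExt

namespace AnnExt
open Metric

/-- The bottom end of the annulus. -/
def botF : Filter Ann := comap (fun x : Ann => (x.2 : ℝ)) (𝓝 0)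

/-- The flip of the open interval. -/
def flipI (t : Ioo (0:ℝ) 1) : Ioo (0:ℝ) 1 := ⟨1 - t, by linarith [t.2.2], by linarith [t.2.1]⟩

/-- The flip of the annulus. -/
def flip : Ann ≃ₜ Ann where
  toFun x := (x.1, flipI x.2)
  invFun x := (x.1, flipI x.2)
  left_inv x := Prod.ext rfl (Subtype.ext (by simp [flipI]))
  right_inv x := Prod.ext rfl (Subtype.ext (by simp [flipI]))
  continuous_toFun := by unfold flipI; fun_prop
  continuous_invFun := by unfold flipI; fun_prop

lemma flip_snd (x : Ann) : ((flip x).2 : ℝ) = 1 - x.2 := rfl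
lemma flip_flip (x : Ann) : flip (flip x) = x := flip.symm_apply_apply x

lemma flip_top : Tendsto flip topF botF := by
  rw [botF, tendsto_comap_iff]
  have h1 : Tendsto (fun t : ℝ => 1 - t) (𝓝 1) (𝓝 0) := by
    have : Continuous (fun t : ℝ => 1 - t) := by fun_prop
    simpa using this.tendsto 1
  exact h1.comp tendsto_comap

lemma flip_bot : Tendsto flip botF topF := by
  rw [topF, tendsto_comap_iff]
  have h1 : Tendsto (fun t : ℝ => 1 - t) (𝓝 0) (𝓝 1) := by
    have : Continuous (fun t : ℝ => 1 - t) := by fun_prop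
    simpa using this.tendsto 0
  exact h1.comp tendsto_comap

lemma mem_topF {S : Set Ann} : S ∈ topF ↔ ∃ ε > 0, ∀ x : Ann, 1 - ε < (x.2 : ℝ) → x ∈ S := by
  constructor
  · intro h
    obtain ⟨V, hV, hVS⟩ := mem_comap.1 h
    obtain ⟨ε, hε, hb⟩ := Metric.mem_nhds_iff.1 hV
    refine ⟨ε, hε, fun x hx => hVS (hb ?_)⟩
    rw [Metric.mem_ball, Real.dist_eq, abs_lt]
    constructor <;> linarith [x.2.2.2]
  · rintro ⟨ε, hε, h⟩
    refine mem_comap.2 ⟨Ioi (1 - ε), Ioi_mem_nhds (by linarith), fun x hx => h x hx⟩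

lemma mem_botF {S : Set Ann} : S ∈ botF ↔ ∃ ε > 0, ∀ x : Ann, (x.2 : ℝ) < ε → x ∈ S := by
  constructor
  · intro h
    obtain ⟨V, hV, hVS⟩ := mem_comap.1 h
    obtain ⟨ε, hε, hb⟩ := Metric.mem_nhds_iff.1 hV
    refine ⟨ε, hε, fun x hx => hVS (hb ?_)⟩
    rw [Metric.mem_ball, Real.dist_eq, abs_lt]
    constructor <;> linarith [x.2.2.1]
  · rintro ⟨ε, hε, h⟩
    refine mem_comap.2 ⟨Iio ε, Iio_mem_nhds (by linarith), fun x hx => h x hx⟩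

instance topF_neBot : NeBot topF := by
  rw [neBot_iff]
  intro h
  have : (∅ : Set Ann) ∈ topF := by rw [h]; trivial
  obtain ⟨ε, hε, h⟩ := mem_topF.1 this
  have h1 : 0 < min ε 1 := lt_min hε one_pos
  have h2 := min_le_left ε 1
  have h3 := min_le_right ε 1
  exact h (1, ⟨1 - min ε 1 / 2, by linarith, by linarith⟩) (by change _ < 1 - min ε 1 / 2; linarith)

lemma upper_mem {c : ℝ} (hc : c < 1) : {x : Ann | c < (x.2 : ℝ)} ∈ topF :=
  mem_topF.2 ⟨1 - c, by linarith, fun x hx => by simpa using hx⟩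

lemma lower_mem {c : ℝ} (hc : 0 < c) : {x : Ann | (x.2 : ℝ) < c} ∈ botF :=
  mem_botF.2 ⟨c, hc, fun x hx => hx⟩

lemma disj : Disjoint topF botF := by
  refine Filter.disjoint_iff.2 ⟨_, upper_mem (c := 1/2) (by norm_num), _,
    lower_mem (c := 1/2) (by norm_num), ?_⟩
  rw [Set.disjoint_left]
  intro x hx hy
  simp only [mem_setOf_eq] at hx hy
  linarith


lemma no_top_bot : ¬ Tendsto (fun x : Ann => x) topF botF := by
  intro h
  have h1 : topF ≤ botF := by simpa [Tendsto] using h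
  exact topF_neBot.ne (disj le_rfl h1 |> le_bot_iff.1)

lemma no_bot_top : ¬ Tendsto (fun x : Ann => x) botF topF := by
  intro h
  apply no_top_bot
  refine (flip_top.comp (h.comp flip_top)).congr fun x => ?_
  exact flip_flip x

lemma isCompact_band {a b : ℝ} (ha : 0 < a) (hb : b < 1) :
    IsCompact {x : Ann | (x.2 : ℝ) ∈ Icc a b} := by
  have h1 : IsCompact ((Subtype.val : Ioo (0:ℝ) 1 → ℝ) ⁻¹' Icc a b) := by
    rw [IsInducing.subtypeVal.isCompact_preimage_iff]
    · exact isCompact_Icc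
    · intro t ht
      exact ⟨⟨t, ha.trans_le ht.1, ht.2.trans_lt hb⟩, rfl⟩
  have h2 := (isCompact_univ (X := Circle)).prod h1
  convert h2 using 1
  ext x
  simp

lemma cocompact_le : cocompact Ann ≤ topF ⊔ botF := by
  intro S hS
  rw [mem_sup] at hS
  obtain ⟨ε, hε, h1⟩ := mem_topF.1 hS.1
  obtain ⟨δ, hδ, h2⟩ := mem_botF.1 hS.2
  refine mem_cocompact.2 ⟨_, isCompact_band (a := δ) (b := 1 - ε) hδ (by linarith), ?_⟩
  intro x hx
  by_cases h3 : (x.2 : ℝ) < δ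
  · exact h2 x h3
  · apply h1
    by_contra h4
    exact hx ⟨not_lt.1 h3, not_lt.1 h4⟩

lemma le_cocompact : topF ≤ cocompact Ann := by
  intro S hS
  obtain ⟨C, hC, hCS⟩ := mem_cocompact.1 hS
  have h1 : IsCompact ((fun x : Ann => (x.2 : ℝ)) '' C) := hC.image (by fun_prop)
  refine mem_comap.2 ⟨_, h1.isClosed.isOpen_compl.mem_nhds ?_, ?_⟩
  · rintro ⟨x, hx, hx1⟩
    have := x.2.2.2
    simp only at hx1
    linarith
  · intro x hx
    apply hCS
    intro hxC
    exact hx ⟨x, hxC, rfl⟩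

lemma preconn_upper {c : ℝ} (hc : c ∈ Ioo (0:ℝ) 1) : IsPreconnected {x : Ann | c < (x.2 : ℝ)} := by
  have hC : IsPreconnected (univ : Set Circle) := by
    have h1 : IsPreconnected (range Circle.exp) := isPreconnected_range Circle.exp.continuous
    rwa [Circle.exp_surjective.range_eq] at h1
  have h1 : IsPreconnected ((Subtype.val : Ioo (0:ℝ) 1 → ℝ) ⁻¹' Ioo c 1) := by
    rw [← IsInducing.subtypeVal.isPreconnected_image, image_preimage_eq_inter_range,
      Subtype.range_val]
    have : Ioo c 1 ∩ Ioo 0 1 = Ioo c 1 := inter_eq_left.2 (Ioo_subset_Ioo_left hc.1.le)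
    rw [this]
    exact isPreconnected_Ioo
  have h2 := hC.prod h1
  convert h2 using 1
  ext x
  simp [x.2.2.2]

lemma top_or (h : Ann ≃ₜ Ann) : Tendsto h topF topF ∨ Tendsto h topF botF := by
  have h1 : Tendsto h topF (topF ⊔ botF) :=
    (h.isClosedEmbedding.tendsto_cocompact.mono_left le_cocompact).mono_right cocompact_le
  have h2 : {x : Ann | (x.2 : ℝ) ≠ 1 / 2} ∈ topF ⊔ botF := by
    refine mem_sup.2 ⟨?_, ?_⟩
    · filter_upwards [upper_mem (c := 1/2) (by norm_num)] with x hx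
      exact ne_of_gt hx
    · filter_upwards [lower_mem (c := 1/2) (by norm_num)] with x hx
      exact ne_of_lt hx
  obtain ⟨ε, hε, h3⟩ := mem_topF.1 (h1 h2)
  have hm : 0 < min ε (1/2) := lt_min hε (by norm_num)
  have hm1 := min_le_left ε (1/2)
  have hm2 := min_le_right ε (1/2)
  set c := 1 - min ε (1/2) with hcdef
  have hc : c ∈ Ioo (0:ℝ) 1 := ⟨by linarith, by linarith⟩
  have h4 : IsPreconnected ((fun x : Ann => ((h x).2 : ℝ)) '' {x : Ann | c < (x.2 : ℝ)}) :=
    (preconn_upper hc).image _ (by fun_prop)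
  have h5 : ∀ x : Ann, c < (x.2 : ℝ) → ((h x).2 : ℝ) ≠ 1/2 := fun x hx => h3 x (by linarith)
  have key : (∀ x : Ann, c < (x.2 : ℝ) → 1/2 < ((h x).2 : ℝ)) ∨
      (∀ x : Ann, c < (x.2 : ℝ) → ((h x).2 : ℝ) < 1/2) := by
    by_contra hcon
    push Not at hcon
    obtain ⟨⟨x, hx, hx1⟩, ⟨y, hy, hy1⟩⟩ := hcon
    have : (1/2 : ℝ) ∈ ((fun x : Ann => ((h x).2 : ℝ)) '' {x : Ann | c < (x.2 : ℝ)}) :=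
      h4.ordConnected.out ⟨x, hx, rfl⟩ ⟨y, hy, rfl⟩ ⟨hx1, hy1⟩
    obtain ⟨w, hw, hw1⟩ := this
    exact h5 w hw hw1
  have hup := upper_mem hc.2
  rcases key with key | key
  · left
    intro S hS
    have : S ∪ {x : Ann | (x.2 : ℝ) < 1/2} ∈ topF ⊔ botF :=
      mem_sup.2 ⟨mem_of_superset hS subset_union_left,
        mem_of_superset (lower_mem (by norm_num)) subset_union_right⟩
    rw [mem_map]
    filter_upwards [h1 this, hup] with x hx hx1
    rcases hx with hx | hx
    · exact hx
    · exact absurd hx (not_lt.2 (key x hx1).le)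
  · right
    intro S hS
    have : S ∪ {x : Ann | 1/2 < (x.2 : ℝ)} ∈ topF ⊔ botF :=
      mem_sup.2 ⟨mem_of_superset (upper_mem (by norm_num)) subset_union_right,
        mem_of_superset hS subset_union_left⟩
    rw [mem_map]
    filter_upwards [h1 this, hup] with x hx hx1
    rcases hx with hx | hx
    · exact hx
    · exact absurd hx (not_lt.2 (key x hx1).le)

lemma top_symm {h : Ann ≃ₜ Ann} (h1 : Tendsto h topF topF) : Tendsto h.symm topF topF := by
  rcases top_or h.symm with h2 | h2
  · exact h2
  · exfalso
    apply no_top_bot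
    exact (h2.comp h1).congr fun x => h.symm_apply_apply x

/-- Conjugation by the flip. -/
def conj (h : Ann ≃ₜ Ann) : Ann ≃ₜ Ann := (flip.trans h).trans flip

lemma conj_apply (h : Ann ≃ₜ Ann) (x : Ann) : conj h x = flip (h (flip x)) := rfl

lemma conj_top {h : Ann ≃ₜ Ann} (h1 : Tendsto h topF topF) : Tendsto (conj h) topF topF := by
  rcases top_or (conj h) with h2 | h2
  · exact h2
  · exfalso
    apply no_bot_top
    have h3 : Tendsto h botF topF := by
      refine (flip_bot.comp (h2.comp flip_bot)).congr fun x => ?_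
      simp only [Function.comp_apply, conj_apply, flip_flip]
    exact ((top_symm h1).comp h3).congr fun x => h.symm_apply_apply x

end AnnExt

namespace AnnExt
open Metric

/-- The flip of the closed annulus. -/
def clFlip : ClAnn ≃ₜ ClAnn where
  toFun x := (x.1, ⟨1 - x.2, by linarith [x.2.2.2], by linarith [x.2.2.1]⟩)
  invFun x := (x.1, ⟨1 - x.2, by linarith [x.2.2.2], by linarith [x.2.2.1]⟩)
  left_inv x := Prod.ext rfl (Subtype.ext (by simp))
  right_inv x := Prod.ext rfl (Subtype.ext (by simp))
  continuous_toFun := by fun_prop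
  continuous_invFun := by fun_prop

lemma emb_flip (x : Ann) : emb (flip x) = clFlip (emb x) := rfl
lemma clFlip_zero (z : Circle) : clFlip (z, 0) = (z, 1) := Prod.ext rfl (Subtype.ext (by simp [clFlip]))
lemma clFlip_one (z : Circle) : clFlip (z, 1) = (z, 0) := Prod.ext rfl (Subtype.ext (by simp [clFlip]))

lemma dense_emb : IsDenseInducing emb := by
  have h1 : emb = Prod.map (id : Circle → Circle)
    (inclusion (Ioo_subset_Icc_self (a := (0:ℝ)) (b := 1))) := rfl
  rw [h1]
  have h2 : IsInducing (inclusion (Ioo_subset_Icc_self (a := (0:ℝ)) (b := 1))) :=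
    (IsEmbedding.inclusion _).isInducing
  refine ⟨IsInducing.id.prodMap h2, ?_⟩
  refine DenseRange.prodMap denseRange_id ?_
  rw [denseRange_inclusion_iff, closure_Ioo (by norm_num)]

lemma emb_inj : Function.Injective emb := by
  intro x y h
  have h1 := congrArg Prod.fst h
  have h2 := congrArg (fun p : ClAnn => (p.2 : ℝ)) h
  exact Prod.ext h1 (Subtype.ext h2)

lemma emb_snd (x : Ann) : ((emb x).2 : ℝ) = x.2 := rfl

lemma cl_cases (y : ClAnn) : (∃ x, y = emb x) ∨ (∃ z, y = (z, 1)) ∨ ∃ z, y = (z, 0) := by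
  obtain ⟨z, t, ht0, ht1⟩ := y
  rcases ht0.eq_or_lt with h | h
  · right; right
    exact ⟨z, Prod.ext rfl (Subtype.ext h.symm)⟩
  · rcases ht1.eq_or_lt with h' | h'
    · right; left
      exact ⟨z, Prod.ext rfl (Subtype.ext h')⟩
    · left
      exact ⟨(z, ⟨t, h, h'⟩), rfl⟩

lemma emb_ne_one (x : Ann) (z : Circle) : emb x ≠ (z, 1) := by
  intro h
  have h2 := congrArg (fun p : ClAnn => (p.2 : ℝ)) h
  have := x.2.2.2
  simp only [emb_snd, Icc.coe_one] at h2
  linarith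

lemma emb_ne_zero (x : Ann) (z : Circle) : emb x ≠ (z, 0) := by
  intro h
  have h2 := congrArg (fun p : ClAnn => (p.2 : ℝ)) h
  have := x.2.2.1
  simp only [emb_snd, Icc.coe_zero] at h2
  linarith

lemma one_ne_zero' (z w : Circle) : ((z, 1) : ClAnn) ≠ (w, 0) := by
  intro h
  have h2 := congrArg (fun p : ClAnn => (p.2 : ℝ)) h
  simp at h2

/-- A homeomorphism with boundary limits extends to the closed annulus. -/
theorem extend_of_limits (f : Ann ≃ₜ Ann) (b c : Circle → Circle) (hb : Function.Bijective b)
    (hc : Function.Bijective c)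
    (h1 : ∀ z, Tendsto (fun x => emb (f x)) (comap emb (𝓝 (z, 1))) (𝓝 (b z, 1)))
    (h0 : ∀ z, Tendsto (fun x => emb (f x)) (comap emb (𝓝 (z, 0))) (𝓝 (c z, 0))) :
    ∃ F : ClAnn ≃ₜ ClAnn, ∀ x, F (emb x) = emb (f x) := by
  have hcf : Continuous (fun x => emb (f x)) := dense_emb.continuous.comp f.continuous
  set G : ClAnn → ClAnn := dense_emb.extend (fun x => emb (f x)) with hG
  have G1 : ∀ z, G (z, 1) = (b z, 1) := fun z => dense_emb.extend_eq_of_tendsto (h1 z)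
  have G0 : ∀ z, G (z, 0) = (c z, 0) := fun z => dense_emb.extend_eq_of_tendsto (h0 z)
  have Ge : ∀ x, G (emb x) = emb (f x) := fun x => dense_emb.extend_eq hcf x
  have hGc : Continuous G := by
    refine dense_emb.continuous_extend fun y => ?_
    rcases cl_cases y with ⟨x, rfl⟩ | ⟨z, rfl⟩ | ⟨z, rfl⟩
    · rw [← dense_emb.nhds_eq_comap]
      exact ⟨_, hcf.tendsto x⟩
    · exact ⟨_, h1 z⟩
    · exact ⟨_, h0 z⟩
  have hinj : Function.Injective G := by
    intro y y' h
    rcases cl_cases y with ⟨x, rfl⟩ | ⟨z, rfl⟩ | ⟨z, rfl⟩ <;>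
      rcases cl_cases y' with ⟨x', rfl⟩ | ⟨z', rfl⟩ | ⟨z', rfl⟩ <;>
      simp only [G1, G0, Ge] at h
    · rw [f.injective (emb_inj h)]
    · exact absurd h (emb_ne_one _ _)
    · exact absurd h (emb_ne_zero _ _)
    · exact absurd h.symm (emb_ne_one _ _)
    · rw [hb.1 (congrArg Prod.fst h)]
    · exact absurd h (one_ne_zero' _ _)
    · exact absurd h.symm (emb_ne_zero _ _)
    · exact absurd h.symm (one_ne_zero' _ _)
    · rw [hc.1 (congrArg Prod.fst h)]
  have hsurj : Function.Surjective G := by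
    intro y
    rcases cl_cases y with ⟨x, rfl⟩ | ⟨z, rfl⟩ | ⟨z, rfl⟩
    · exact ⟨emb (f.symm x), by rw [Ge, f.apply_symm_apply]⟩
    · obtain ⟨w, rfl⟩ := hb.2 z
      exact ⟨_, G1 w⟩
    · obtain ⟨w, rfl⟩ := hc.2 z
      exact ⟨_, G0 w⟩
  refine ⟨Continuous.homeoOfEquivCompactToT2 (f := Equiv.ofBijective G ⟨hinj, hsurj⟩) hGc, ?_⟩
  intro x
  exact Ge x

lemma exists_band {K : Set Ann} (hK : IsCompact K) : ∃ s ∈ Ioo (0:ℝ) 1, ∃ t ∈ Ioo (0:ℝ) 1,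
    s < t ∧ ∀ x ∈ K, s ≤ (x.2 : ℝ) ∧ (x.2 : ℝ) ≤ t := by
  rcases K.eq_empty_or_nonempty with rfl | hne
  · exact ⟨1/3, by constructor <;> norm_num, 1/2, by constructor <;> norm_num, by norm_num, by simp⟩
  · have hc : ContinuousOn (fun x : Ann => (x.2 : ℝ)) K := by fun_prop
    obtain ⟨a, ha, ha'⟩ := hK.exists_isMinOn hne hc
    obtain ⟨b, hb, hb'⟩ := hK.exists_isMaxOn hne hc
    have a1 := a.2.2.1
    have b1 := b.2.2.2
    have hab : (a.2 : ℝ) ≤ b.2 := ha' hb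
    refine ⟨a.2 / 2, ⟨by linarith, by linarith⟩, (1 + b.2) / 2, ⟨by linarith, by linarith⟩,
      by linarith, fun x hx => ?_⟩
    have h1 : (a.2 : ℝ) ≤ x.2 := ha' hx
    have h2 : (x.2 : ℝ) ≤ b.2 := hb' hx
    constructor <;> linarith

lemma ext_top (h : Ann ≃ₜ Ann) (ht : Tendsto h topF topF) {K : Set Ann} (hK : IsCompact K) :
    ∃ F : ClAnn ≃ₜ ClAnn, ∀ x ∈ K, F (emb x) = emb (h x) := by
  obtain ⟨s, hs, t, htt, hst, hKst⟩ := exists_band hK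
  obtain ⟨k₁, hk₁, b, hb, hlim₁⟩ := top_lemma h ht (top_symm ht) htt
  have hs' : 1 - s ∈ Ioo (0:ℝ) 1 := ⟨by linarith [hs.2], by linarith [hs.1]⟩
  obtain ⟨k, hk, c, hc, hlim⟩ := top_lemma (conj h) (conj_top ht) (top_symm (conj_top ht)) hs'
  have hk₂ : ∀ x : Ann, s ≤ (x.2 : ℝ) → conj k x = x := by
    intro x hx
    rw [conj_apply, hk, flip_flip]
    rw [flip_snd]; linarith
  have hk₂' : ∀ x : Ann, (x.2 : ℝ) < s → ((conj k x).2 : ℝ) < s := by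
    intro x hx
    by_contra hcon
    have h1 := (conj k).injective (hk₂ _ (not_lt.1 hcon))
    rw [h1] at hcon
    exact hcon hx
  have hsnd : Continuous (fun y : ClAnn => (y.2 : ℝ)) := by fun_prop
  have hF : ∃ F : ClAnn ≃ₜ ClAnn, ∀ x, F (emb x) = emb (((conj k).trans (k₁.trans h)) x) := by
    refine extend_of_limits _ b c hb hc (fun z => ?_) (fun z => ?_)
    · refine (hlim₁ z).congr' ?_
      have h1 : ∀ᶠ y : ClAnn in 𝓝 (z, 1), s < (y.2 : ℝ) :=
        (hsnd.tendsto (z, 1)).eventually (lt_mem_nhds (by simpa using hs.2))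
      filter_upwards [h1.comap emb] with x hx
      change emb (h (k₁ x)) = emb (h (k₁ (conj k x)))
      rw [hk₂ x (le_of_lt hx)]
    · have h2 : Tendsto flip (comap emb (𝓝 (z, 0))) (comap emb (𝓝 (z, 1))) := by
        rw [tendsto_comap_iff]
        have h3 := (clFlip.continuous.tendsto (z, 0)).comp (tendsto_comap (f := emb))
        rw [clFlip_zero] at h3
        exact h3
      have h4 := ((clFlip.continuous.tendsto (c z, 1)).comp (hlim z)).comp h2
      rw [clFlip_one] at h4
      refine h4.congr' ?_
      have h1 : ∀ᶠ y : ClAnn in 𝓝 (z, 0), (y.2 : ℝ) < s :=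
        (hsnd.tendsto (z, 0)).eventually (gt_mem_nhds (by simpa using hs.1))
      filter_upwards [h1.comap emb] with x hx
      change clFlip (emb (conj h (k (flip x)))) = emb (h (k₁ (conj k x)))
      rw [hk₁ _ ((hk₂' x hx).le.trans hst.le), ← emb_flip, conj_apply, flip_flip]
      rfl
  obtain ⟨F, hF⟩ := hF
  refine ⟨F, fun x hx => ?_⟩
  rw [hF]
  change emb (h (k₁ (conj k x))) = _
  rw [hk₂ x (hKst x hx).1, hk₁ x (hKst x hx).2]

/-- A homeomorphism of the open annulus agrees on a compact set with a homeomorphism of the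
closed annulus. -/
theorem ext_homeo (h : Ann ≃ₜ Ann) {K : Set Ann} (hK : IsCompact K) :
    ∃ F : ClAnn ≃ₜ ClAnn, ∀ x ∈ K, F (emb x) = emb (h x) := by
  rcases top_or h with ht | ht
  · exact ext_top h ht hK
  · obtain ⟨F, hF⟩ := ext_top (h.trans flip) (flip_bot.comp ht) hK
    refine ⟨F.trans clFlip, fun x hx => ?_⟩
    change clFlip (F (emb x)) = _
    rw [hF x hx, ← emb_flip]
    change emb (flip (flip (h x))) = _
    rw [flip_flip]

end AnnExt

namespace AnnExt
open Metric

/-- The exponential covering of the circle with period one. -/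
def ee (x : ℝ) : Circle := Circle.exp (2 * Real.pi * x)

lemma two_pi_ne : (2 * Real.pi : ℝ) ≠ 0 := by positivity

lemma ee_cov : IsCoveringMap ee :=
  Circle.isCoveringMap_exp.comp_homeomorph (Homeomorph.mulLeft₀ (2 * Real.pi) two_pi_ne)

lemma ee_surj : Function.Surjective ee := by
  intro z
  obtain ⟨x, rfl⟩ := Circle.exp_surjective z
  refine ⟨x / (2 * Real.pi), ?_⟩
  rw [ee, mul_div_cancel₀ _ two_pi_ne]

lemma ee_add_int (x : ℝ) (n : ℤ) : ee (x + n) = ee x := by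
  unfold ee
  rw [Circle.exp_eq_exp]
  exact ⟨n, by ring⟩

lemma ee_eq {x y : ℝ} (h : ee x = ee y) : ∃ n : ℤ, x = y + n := by
  unfold ee at h
  obtain ⟨n, hn⟩ := Circle.exp_eq_exp.1 h
  refine ⟨n, mul_left_cancel₀ two_pi_ne ?_⟩
  rw [hn]; ring

lemma ee_mul_int (x : ℝ) (n : ℤ) : ee (n * x) = ee x ^ n := by
  unfold ee
  rw [← Circle.exp_zsmul]
  congr 1
  rw [zsmul_eq_mul]; ring

/-- The power map of the closed annulus. -/
def clPow (d : ℤ) (x : ClAnn) : ClAnn := (x.1 ^ d, x.2)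

/-- The power map of the open annulus. -/
def anPow (d : ℤ) (x : Ann) : Ann := (x.1 ^ d, x.2)

lemma emb_anPow (d : ℤ) (x : Ann) : emb (anPow d x) = clPow d (emb x) := rfl

lemma zpow_local {d : ℤ} (hd : d ≠ 0) : IsLocalHomeomorph (fun z : Circle => z ^ d) := by
  have hd' : (d : ℝ) ≠ 0 := by exact_mod_cast hd
  have h1 : IsLocalHomeomorph ((fun z : Circle => z ^ d) ∘ ee) := by
    have h2 := (ee_cov.comp_homeomorph (Homeomorph.mulLeft₀ (d : ℝ) hd')).isLocalHomeomorph
    convert h2 using 1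
    funext x
    exact (ee_mul_int x d).symm
  have h3 := h1.isLocalHomeomorphOn (s := univ) |>.of_comp_right
    (ee_cov.isLocalHomeomorph.isLocalHomeomorphOn (s := univ))
  rw [image_univ, ee_surj.range_eq] at h3
  exact isLocalHomeomorph_iff_isLocalHomeomorphOn_univ.2 h3

lemma clPow_cov {d : ℤ} (hd : d ≠ 0) : IsCoveringMap (clPow d) := by
  rw [← isLocalHomeomorph_iff_isCoveringMap]
  intro x
  obtain ⟨φ, hφ, hφ'⟩ := zpow_local hd x.1
  refine ⟨φ.prod (OpenPartialHomeomorph.refl _), ⟨hφ, trivial⟩, ?_⟩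
  funext y
  change (y.1 ^ d, y.2) = (φ y.1, y.2)
  rw [← hφ']

instance : LocallyPathConnectedSpace (Ioo (0:ℝ) 1) := isOpen_Ioo.locallyPathConnectedSpace
instance : ContractibleSpace (Ioo (0:ℝ) 1) :=
  (convex_Ioo 0 1).contractibleSpace ⟨1/2, by norm_num, by norm_num⟩
instance : SimplyConnectedSpace AnnTil := SimplyConnectedSpace.ofContractible _

lemma pr_eq (x : AnnTil) : pr x = (ee x.1, x.2) := rfl

lemma pr_surj : Function.Surjective pr := by
  rintro ⟨z, t⟩
  obtain ⟨x, rfl⟩ := ee_surj z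
  exact ⟨(x, t), rfl⟩

lemma pr_cont : Continuous pr :=
  (ee_cov.continuous.comp continuous_fst).prodMk continuous_snd

lemma pr_quot : IsQuotientMap pr := by
  have h : IsOpenMap pr := ee_cov.isOpenMap.prodMap IsOpenMap.id
  exact h.isQuotientMap pr_cont pr_surj

lemma pr_tr (x : AnnTil) (n : ℤ) : pr (tr x n) = pr x := by
  rw [pr_eq, pr_eq]
  change (ee (x.1 + n), x.2) = _
  rw [ee_add_int]

lemma pr_fib {x y : AnnTil} (h : pr x = pr y) : ∃ n : ℤ, x = tr y n := by
  rw [pr_eq, pr_eq] at h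
  obtain ⟨n, hn⟩ := ee_eq (congrArg Prod.fst h)
  have h2 := congrArg Prod.snd h
  exact ⟨n, Prod.ext hn h2⟩

lemma tr_cont (n : ℤ) : Continuous (fun x => tr x n) := by unfold tr; fun_prop

lemma lift_pr {f : AnnTil → Ann} (hf : Continuous f) {a y : AnnTil} (h : pr y = f a) :
    ∃ F : AnnTil → AnnTil, Continuous F ∧ F a = y ∧ ∀ x, pr (F x) = f x := by
  have hfc : Continuous (fun x => (f x).1) := continuous_fst.comp hf
  obtain ⟨Φ, ⟨h1, h2⟩, -⟩ := ee_cov.existsUnique_continuousMap_lifts ⟨_, hfc⟩ a y.1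
    (congrArg Prod.fst h)
  refine ⟨fun x => (Φ x, (f x).2), Φ.continuous.prodMk (continuous_snd.comp hf), ?_, ?_⟩
  · exact Prod.ext h1 (congrArg Prod.snd h).symm
  · intro x
    exact Prod.ext (congrFun h2 x) rfl

lemma uniq_pr {F G : AnnTil → AnnTil} (hF : Continuous F) (hG : Continuous G)
    (h : ∀ x, pr (F x) = pr (G x)) (a : AnnTil) (ha : F a = G a) (x : AnnTil) : F x = G x := by
  have h1 : (fun x => (F x).1) = fun x => (G x).1 := by
    refine ee_cov.eq_of_comp_eq (continuous_fst.comp hF) (continuous_fst.comp hG) ?_ a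
      (congrArg Prod.fst ha)
    funext x
    exact congrArg Prod.fst (h x)
  have h2 : (pr (F x)).2 = (pr (G x)).2 := congrArg Prod.snd (h x)
  exact Prod.ext (congrFun h1 x) h2

lemma tr_equivariant {F : AnnTil → AnnTil} (h : ∀ x, F (tr x 1) = tr (F x) 1) (n : ℤ)
    (x : AnnTil) : F (tr x n) = tr (F x) n := by
  have hadd : ∀ (x : AnnTil) (m n : ℤ), tr (tr x m) n = tr x (m + n) := by
    intro x m n
    refine Prod.ext ?_ rfl
    change x.1 + m + n = x.1 + ((m + n : ℤ) : ℝ)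
    push_cast; ring
  have h0 : ∀ x : AnnTil, tr x 0 = x := by
    intro x
    refine Prod.ext ?_ rfl
    change x.1 + ((0 : ℤ) : ℝ) = x.1
    simp
  have hm : ∀ x, F (tr x (-1)) = tr (F x) (-1) := by
    intro x
    have h2 := h (tr x (-1))
    rw [hadd] at h2
    norm_num at h2
    rw [h0] at h2
    rw [h2, hadd]
    norm_num
    rw [h0]
  induction n using Int.induction_on generalizing x with
  | zero => rw [h0, h0]
  | succ n ih => rw [← hadd, h, ih, hadd]
  | pred n ih => rw [sub_eq_add_neg, ← hadd, hm, ih, hadd]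

lemma descend {F : AnnTil → AnnTil} (hF : Continuous F) (h : ∀ x, F (tr x 1) = tr (F x) 1) :
    ∃ f : Ann → Ann, Continuous f ∧ ∀ x, f (pr x) = pr (F x) := by
  have h1 : ∀ x, pr (F (Function.surjInv pr_surj (pr x))) = pr (F x) := by
    intro x
    obtain ⟨n, hn⟩ := pr_fib (Function.surjInv_eq pr_surj (pr x))
    rw [hn, tr_equivariant h, pr_tr]
  refine ⟨fun y => pr (F (Function.surjInv pr_surj y)), ?_, h1⟩
  rw [pr_quot.continuous_iff]
  refine (pr_cont.comp hF).congr fun x => (h1 x).symm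

/-- A covering map of the annulus is a power map composed with a homeomorphism. -/
theorem factor {g : Ann → Ann} (hg : IsCoveringMap g) :
    ∃ d : ℤ, d ≠ 0 ∧ ∃ h : Ann ≃ₜ Ann, ∀ x, g x = anPow d (h x) := by
  set a : AnnTil := (0, ⟨1/2, by norm_num, by norm_num⟩) with ha
  obtain ⟨b, hb⟩ := pr_surj (g (pr a))
  obtain ⟨G, hGc, hGa, hG⟩ := lift_pr (hg.continuous.comp pr_cont) (a := a) hb
  obtain ⟨l, ⟨hl1, hl2⟩, -⟩ := hg.existsUnique_continuousMap_lifts ⟨pr, pr_cont⟩ b (pr a) hb.symm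
  have hl2 : ∀ x, g (l x) = pr x := fun x => congrFun hl2 x
  obtain ⟨k, hkc, hkb, hk⟩ := lift_pr l.continuous (a := b) (y := a) hl1.symm
  have hGk : ∀ x, G (k x) = x := by
    refine uniq_pr (hGc.comp hkc) continuous_id (fun x => ?_) b ?_
    · change pr (G (k x)) = pr x
      rw [hG, Function.comp_apply, hk, hl2]
    · change G (k b) = b
      rw [hkb, hGa]
  have hkG : ∀ x, k (G x) = x := by
    have h1 : (fun x => pr (k (G x))) = pr := by
      refine hg.eq_of_comp_eq (pr_cont.comp (hkc.comp hGc)) pr_cont ?_ a ?_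
      · funext x
        change g (pr (k (G x))) = g (pr x)
        rw [hk, hl2, hG]
        rfl
      · change pr (k (G a)) = pr a
        rw [hGa, hkb]
    refine uniq_pr (hkc.comp hGc) continuous_id (fun x => congrFun h1 x) a ?_
    change k (G a) = a
    rw [hGa, hkb]
  have hprG : ∀ x n, pr (G (tr x n)) = pr (G x) := by
    intro x n
    rw [hG, hG, Function.comp_apply, Function.comp_apply, pr_tr]
  obtain ⟨d, hd⟩ := pr_fib (hprG a 1)
  have hGd : ∀ x, G (tr x 1) = tr (G x) d := by
    refine uniq_pr (hGc.comp (tr_cont 1)) ((tr_cont d).comp hGc) (fun x => ?_) a hd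
    change pr (G (tr x 1)) = pr (tr (G x) d)
    rw [hprG, pr_tr]
  have hkd : ∀ y, k (tr y d) = tr (k y) 1 := by
    intro y
    rw [← hkG (tr (k y) 1), hGd, hGk]
  have hd0 : d ≠ 0 := by
    rintro rfl
    have h1 : tr (G a) 0 = G a := by
      refine Prod.ext ?_ rfl
      change (G a).1 + ((0 : ℤ) : ℝ) = (G a).1
      simp
    rw [h1] at hd
    have h2 := congrArg k hd
    rw [hkG, hkG] at h2
    have h3 : a.1 + ((1 : ℤ) : ℝ) = a.1 := congrArg Prod.fst h2
    simp at h3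
  have hd' : (d : ℝ) ≠ 0 := by exact_mod_cast hd0
  have hH : ∃ f : Ann → Ann, Continuous f ∧ ∀ x, f (pr x) = pr ((G x).1 / d, (G x).2) := by
    refine descend (F := fun x => ((G x).1 / d, (G x).2)) (by fun_prop) (fun x => ?_)
    refine Prod.ext ?_ ?_
    · change (G (tr x 1)).1 / d = (G x).1 / d + ((1 : ℤ) : ℝ)
      rw [hGd]
      change ((G x).1 + d) / d = _
      rw [add_div, div_self hd']
      simp
    · change (G (tr x 1)).2 = (G x).2
      rw [hGd]
      rfl
  have hM : ∃ f : Ann → Ann, Continuous f ∧ ∀ x, f (pr x) = pr (k (d * x.1, x.2)) := by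
    refine descend (F := fun x => k (d * x.1, x.2)) (by fun_prop) (fun x => ?_)
    change k (d * (x.1 + ((1 : ℤ) : ℝ)), x.2) = _
    rw [← hkd]
    congr 1
    refine Prod.ext ?_ rfl
    change d * (x.1 + ((1 : ℤ) : ℝ)) = d * x.1 + d
    push_cast; ring
  obtain ⟨f, hfc, hf⟩ := hH
  obtain ⟨m, hmc, hm⟩ := hM
  refine ⟨d, hd0, ⟨⟨f, m, ?_, ?_⟩, hfc, hmc⟩, ?_⟩
  · intro y
    obtain ⟨x, rfl⟩ := pr_surj y
    rw [hf, hm]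
    change pr (k (d * ((G x).1 / d), (G x).2)) = pr x
    rw [mul_div_cancel₀ _ hd']
    exact congrArg pr (hkG x)
  · intro y
    obtain ⟨x, rfl⟩ := pr_surj y
    rw [hm, hf, hGk]
    change pr (d * x.1 / d, x.2) = pr x
    rw [mul_div_cancel_left₀ _ hd']
  · intro y
    obtain ⟨x, rfl⟩ := pr_surj y
    change g (pr x) = anPow d (f (pr x))
    rw [hf]
    change _ = (ee ((G x).1 / d) ^ d, (G x).2)
    rw [← ee_mul_int, mul_div_cancel₀ _ hd']
    exact (hG x).symm

end AnnExt

/-- A covering map of the open annulus agrees on any compact set with a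
covering map of the closed annulus. -/
theorem stmt_13 (g : Ann → Ann) (hcov : IsCoveringMap g)
    (K : Set Ann) (hKc : IsCompact K) :
    ∃ g' : ClAnn → ClAnn, IsCoveringMap g' ∧
      ∀ x ∈ K, g' (emb x) = emb (g x) := by
  obtain ⟨d, hd, h, hh⟩ := AnnExt.factor hcov
  obtain ⟨F, hF⟩ := AnnExt.ext_homeo h hKc
  refine ⟨AnnExt.clPow d ∘ F, (AnnExt.clPow_cov hd).comp_homeomorph F, fun x hx => ?_⟩
  rw [Function.comp_apply, hF x hx, hh, AnnExt.emb_anPow]
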